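/- Let d ≥ 3, n, m ≥ 1, q, t ∈ ℕ, and s = (n+1)q. Let P_1, …, P_s be generic points of P^{n+m}, let H_1 ≅ P^{n-1} and H_2 ≅ P^{m-1} be generic linear subspaces of P^{n+m}, and let W_1, …, W_t ⊂ P^{n+m} be t generic linear subspaces of dimension n containing H_1. Let X be the scheme dH_1 + H_2 + 2P_1 + ⋯ + 2P_s + W_1 + ⋯ + W_t, i.e. the scheme defined by the ideal sheaf I_{H_1}^d ∩ I_{H_2} ∩ I_{P_1}^2 ∩ ⋯ ∩ I_{P_s}^2 ∩ I_{W_1} ∩ ⋯ ∩ I_{W_t}. Then the degree d+1 piece of the homogeneous ideal I_X has the expected dimension: dim (I_X)_{d+1} = max{ (n+1)·C(m+d, d) − s(n+m+1) − t(n+1) ; 0 }. -/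

import Mathlib

open MvPolynomial

noncomputable section

/-- The degree-`t` homogeneous piece of an ideal `I` of a polynomial ring, as a
`K`-vector space; `Module.finrank K (piece K I t)` is `dim (I)_t`. -/
def piece (K : Type) [Field K] {ι : Type} (I : Ideal (MvPolynomial ι K)) (t : ℕ) :
    Submodule K (MvPolynomial ι K) :=
  Submodule.restrictScalars K I ⊓ MvPolynomial.homogeneousSubmodule ι K t

/-- The (saturated, radical) homogeneous ideal of the projective linear subspace spanned
by the set `S` of vectors: the ideal generated by all linear forms vanishing on `S`. -/
def linIdeal (K : Type) [Field K] {ι : Type} (S : Set (ι → K)) : Ideal (MvPolynomial ι K) :=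
  Ideal.span { f | f ∈ MvPolynomial.homogeneousSubmodule ι K 1 ∧ ∀ x ∈ S, MvPolynomial.eval x f = 0 }

/-! ### Generic properties -/

/-- A property of points of affine space that holds off a proper hypersurface. -/
def Gen {K τ : Type*} [Field K] (Φ : (τ → K) → Prop) : Prop :=
  ∃ g : MvPolynomial τ K, g ≠ 0 ∧ ∀ x, eval x g ≠ 0 → Φ x

namespace Gen

variable {K τ τ' : Type*} [Field K]

theorem mono {Φ Ψ : (τ → K) → Prop} (h : Gen Φ) (hi : ∀ x, Φ x → Ψ x) : Gen Ψ := by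
  obtain ⟨g, hg, h⟩ := h
  exact ⟨g, hg, fun x hx => hi x (h x hx)⟩

theorem of_forall {Φ : (τ → K) → Prop} (h : ∀ x, Φ x) : Gen Φ :=
  ⟨1, one_ne_zero, fun x _ => h x⟩

theorem and {Φ Ψ : (τ → K) → Prop} (h : Gen Φ) (h' : Gen Ψ) : Gen (fun x => Φ x ∧ Ψ x) := by
  obtain ⟨g, hg, h⟩ := h
  obtain ⟨g', hg', h'⟩ := h'
  refine ⟨g * g', mul_ne_zero hg hg', fun x hx => ?_⟩
  rw [map_mul] at hx
  exact ⟨h x (left_ne_zero_of_mul hx), h' x (right_ne_zero_of_mul hx)⟩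

theorem all {ι : Type*} [Finite ι] {Φ : ι → (τ → K) → Prop} (h : ∀ i, Gen (Φ i)) :
    Gen (fun x => ∀ i, Φ i x) := by
  classical
  have := Fintype.ofFinite ι
  choose g hg h using h
  refine ⟨∏ i, g i, Finset.prod_ne_zero_iff.2 fun i _ => hg i, fun x hx i => h i x ?_⟩
  rw [map_prod] at hx
  exact Finset.prod_ne_zero_iff.1 hx i (Finset.mem_univ i)

theorem exists_point [Infinite K] {Φ : (τ → K) → Prop} (h : Gen Φ) : ∃ x, Φ x := by
  obtain ⟨g, hg, h⟩ := h
  by_contra! hne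
  refine hg (MvPolynomial.funext fun x => ?_)
  by_contra hx
  exact hne x (h x (by simpa using hx))

theorem comap {f : τ → τ'} (hf : Function.Injective f) {Φ : (τ → K) → Prop} (h : Gen Φ) :
    Gen (fun x : τ' → K => Φ (x ∘ f)) := by
  obtain ⟨g, hg, h⟩ := h
  refine ⟨rename f g, fun h0 => hg (rename_injective f hf (by simpa using h0)), fun x hx => h _ ?_⟩
  rwa [eval_rename] at hx

theorem coord_ne_zero (i : τ) : Gen (fun x : τ → K => x i ≠ 0) :=
  ⟨X i, X_ne_zero i, fun x hx => by simpa using hx⟩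

end Gen

/-- The common kernel at the parameter `x` of a family of functionals depending polynomially
on parameters. -/
def kerAt {K τ β E : Type*} [Field K] [AddCommGroup E] [Module K E]
    (l : β → E →ₗ[K] MvPolynomial τ K) (x : τ → K) : Submodule K E where
  carrier := {e | ∀ b, eval x (l b e) = 0}
  add_mem' h h' b := by simp [h b, h' b]
  zero_mem' b := by simp
  smul_mem' c e h b := by simp [smul_eval, h b]

theorem mem_kerAt {K τ β E : Type*} [Field K] [AddCommGroup E] [Module K E]
    {l : β → E →ₗ[K] MvPolynomial τ K} {x : τ → K} {e : E} :
    e ∈ kerAt l x ↔ ∀ b, eval x (l b e) = 0 := Iff.rfl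

/-- Upper semicontinuity of the dimension of the kernel. -/
theorem Gen.finrank_kerAt_le {K τ β E : Type*} [Field K] [AddCommGroup E] [Module K E]
    [FiniteDimensional K E] [Finite β] (l : β → E →ₗ[K] MvPolynomial τ K) (x₀ : τ → K) :
    ∃ g : MvPolynomial τ K, eval x₀ g ≠ 0 ∧ ∀ x, eval x g ≠ 0 →
      Module.finrank K (kerAt l x) ≤ Module.finrank K (kerAt l x₀) := by
  classical
  have := Fintype.ofFinite β
  obtain ⟨C, hC⟩ := (kerAt l x₀).exists_isCompl
  let ev (x : τ → K) : C →ₗ[K] (β → K) :=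
    LinearMap.pi fun b => (aeval x).toLinearMap ∘ₗ (l b) ∘ₗ C.subtype
  have hev (x) (e : C) (b) : ev x e b = eval x (l b e) := by
    simp [ev, aeval_eq_eval]
  have hinj : LinearMap.ker (ev x₀) = ⊥ := by
    rw [LinearMap.ker_eq_bot']
    intro e he
    have : (e : E) ∈ kerAt l x₀ := fun b => by rw [← hev, he]; rfl
    exact Subtype.ext (Submodule.disjoint_def.1 hC.disjoint _ this e.2)
  obtain ⟨L, hL⟩ := (ev x₀).exists_leftInverse_of_injective hinj
  let v := Module.finBasis K C
  let A : Matrix (Fin (Module.finrank K C)) (Fin (Module.finrank K C)) (MvPolynomial τ K) :=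
    Matrix.of fun i j => ∑ b, MvPolynomial.C (v.repr (L (Pi.single b 1)) i) * l b (v j)
  have hA (x) : A.map (eval x) = LinearMap.toMatrix v v (L ∘ₗ ev x) := by
    ext i j
    rw [LinearMap.toMatrix_apply]
    have : ev x (v j) = ∑ b, (eval x (l b (v j))) • (Pi.single b 1 : β → K) := by
      ext b
      simp [hev, Finset.sum_apply, Pi.single_apply]
    simp only [LinearMap.comp_apply, this, map_sum, map_smul, Matrix.map_apply, A, Matrix.of_apply,
      map_mul, eval_C, Finsupp.coe_finsetSum, Finset.sum_apply, Finsupp.coe_smul, Pi.smul_apply,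
      smul_eq_mul]
    exact Finset.sum_congr rfl fun b _ => mul_comm _ _
  have hdet (x) : eval x A.det = LinearMap.det (L ∘ₗ ev x) := by
    rw [RingHom.map_det, ← LinearMap.det_toMatrix v, ← hA]; rfl
  refine ⟨A.det, ?_, fun x hx => ?_⟩
  · rw [hdet, hL, LinearMap.det_id]; exact one_ne_zero
  · rw [hdet] at hx
    have hk : Disjoint (kerAt l x) C := by
      rw [Submodule.disjoint_def]
      intro e he heC
      by_contra hne
      have h0 : (L ∘ₗ ev x) ⟨e, heC⟩ = 0 := by
        have : ev x ⟨e, heC⟩ = 0 := by ext b; rw [hev]; exact he b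
        rw [LinearMap.comp_apply, this, map_zero]
      refine hx (LinearMap.det_eq_zero_iff_ker_ne_bot.2 ?_)
      intro hb
      have : (⟨e, heC⟩ : C) ∈ LinearMap.ker (L ∘ₗ ev x) := h0
      rw [hb, Submodule.mem_bot] at this
      exact hne (congrArg Subtype.val this)
    have h1 := Submodule.finrank_add_finrank_le_of_disjoint hk
    have h2 := Submodule.finrank_add_eq_of_isCompl hC
    omega

theorem Gen.of_kerAt {K τ β E : Type*} [Field K] [AddCommGroup E] [Module K E]
    [FiniteDimensional K E] [Finite β] (l : β → E →ₗ[K] MvPolynomial τ K) (x₀ : τ → K) {δ : ℕ}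
    (h : Module.finrank K (kerAt l x₀) ≤ δ) :
    Gen (fun x => Module.finrank K (kerAt l x) ≤ δ) := by
  obtain ⟨g, hg, hgx⟩ := Gen.finrank_kerAt_le l x₀
  exact ⟨g, fun h0 => hg (by simp [h0]), fun x hx => (hgx x hx).trans h⟩

/-! ### Homogeneous polynomials with prescribed singular points -/

theorem finrank_le_finrank_ker_add {K V β : Type*} [Field K] [AddCommGroup V] [Module K V]
    [FiniteDimensional K V] [Fintype β] (f : V →ₗ[K] (β → K)) :
    Module.finrank K V ≤ Module.finrank K (LinearMap.ker f) + Fintype.card β := by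
  have h1 := f.finrank_range_add_finrank_ker
  have h2 := (LinearMap.range f).finrank_le
  rw [Module.finrank_pi] at h2
  omega

theorem homogeneousSubmodule_eq_span_monomial (σ K : Type*) [Field K] (d : ℕ) :
    homogeneousSubmodule σ K d
      = Submodule.span K (Set.range fun s : {s : σ →₀ ℕ // s.degree = d} => monomial s.1 (1 : K)) := by
  apply le_antisymm
  · intro f hf
    rw [f.as_sum]
    refine Submodule.sum_mem _ fun s hs => ?_
    have : monomial s (coeff s f) = coeff s f • monomial s (1 : K) := by simp [smul_monomial]
    rw [this]
    refine Submodule.smul_mem _ _ (Submodule.subset_span ⟨⟨s, ?_⟩, rfl⟩)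
    by_contra h
    exact (mem_support_iff.1 hs) (IsHomogeneous.coeff_eq_zero hf h)
  · rw [Submodule.span_le]
    rintro _ ⟨s, rfl⟩
    exact isHomogeneous_monomial 1 s.2

instance instFiniteHomogeneousSubmodule {σ K : Type*} [Field K] [Finite σ] (d : ℕ) :
    FiniteDimensional K (homogeneousSubmodule σ K d) :=
  Module.Finite.iff_fg.2 (homogeneousSubmodule_fg σ K d)

theorem finrank_homogeneousSubmodule (σ K : Type*) [Field K] [Fintype σ] (d : ℕ) :
    Module.finrank K (homogeneousSubmodule σ K d) = (Fintype.card σ).multichoose d := by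
  classical
  have e : Sym σ d ≃ {s : σ →₀ ℕ // s.degree = d} :=
    (Sym.equivNatSum σ d).trans (Equiv.subtypeEquivRight fun s => by
      simp [Finsupp.degree_apply, Finsupp.sum])
  let _ : Fintype {s : σ →₀ ℕ // s.degree = d} := Fintype.ofEquiv _ e
  have hli : LinearIndependent K
      fun s : {s : σ →₀ ℕ // s.degree = d} => monomial s.1 (1 : K) := by
    have := (basisMonomials σ K).linearIndependent.comp (fun s : {s : σ →₀ ℕ // s.degree = d} => s.1)
      Subtype.val_injective
    simpa [Function.comp_def] using this
  rw [homogeneousSubmodule_eq_span_monomial, finrank_span_eq_card hli, ← Fintype.card_congr e,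
    Sym.card_sym_eq_multichoose]

/-- Degree `d` forms all of whose partial derivatives vanish at the points `p i`. -/
def sing {K σ ι : Type*} [Field K] (d : ℕ) (p : ι → σ → K) : Submodule K (MvPolynomial σ K) where
  carrier := {f | f.IsHomogeneous d ∧ ∀ i j, eval (p i) (pderiv j f) = 0}
  add_mem' h h' := ⟨h.1.add h'.1, fun i j => by simp [h.2 i j, h'.2 i j]⟩
  zero_mem' := ⟨isHomogeneous_zero _ _ _, fun i j => by simp⟩
  smul_mem' c f h := ⟨(homogeneousSubmodule σ K d).smul_mem c h.1, fun i j => by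
    simp [smul_eval, h.2 i j]⟩

section
variable {K σ ι : Type*} [Field K] {d : ℕ}

theorem mem_sing {p : ι → σ → K} {f : MvPolynomial σ K} :
    f ∈ sing d p ↔ f.IsHomogeneous d ∧ ∀ i j, eval (p i) (pderiv j f) = 0 := Iff.rfl

theorem sing_le (p : ι → σ → K) : sing d p ≤ homogeneousSubmodule σ K d := fun _ h => h.1

instance instFiniteSing [Finite σ] (p : ι → σ → K) : FiniteDimensional K (sing d p) :=
  Submodule.finiteDimensional_of_le (sing_le p)

theorem sing_anti {κ : Type*} (p : ι → σ → K) (q : κ → σ → K) (h : ∀ k, ∃ i, q k = p i) :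
    sing d p ≤ sing d q := fun f hf => ⟨hf.1, fun k j => by
  obtain ⟨i, hi⟩ := h k
  rw [hi]; exact hf.2 i j⟩

theorem finrank_sing_comp_le {κ : Type*} [Fintype σ] [Fintype ι] [Fintype κ] (p : ι → σ → K)
    (e : κ → ι) (he : Function.Injective e) :
    Module.finrank K (sing d (p ∘ e)) + Fintype.card κ * Fintype.card σ
      ≤ Module.finrank K (sing d p) + Fintype.card ι * Fintype.card σ := by
  classical
  let f : sing d (p ∘ e) →ₗ[K] ({i // i ∉ Set.range e} × σ → K) :=
    LinearMap.pi fun b => (aeval (p b.1)).toLinearMap ∘ₗ (pderiv b.2).toLinearMap ∘ₗ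
      (sing d (p ∘ e)).subtype
  have h1 := finrank_le_finrank_ker_add f
  have h2 : Module.finrank K (LinearMap.ker f) ≤ Module.finrank K (sing d p) := by
    let g : LinearMap.ker f →ₗ[K] sing d p :=
      LinearMap.codRestrict _ ((sing d (p ∘ e)).subtype ∘ₗ (LinearMap.ker f).subtype) fun x => by
        refine ⟨x.1.2.1, fun i j => ?_⟩
        by_cases hi : i ∈ Set.range e
        · obtain ⟨k, rfl⟩ := hi
          exact x.1.2.2 k j
        · have := congrFun (LinearMap.mem_ker.1 x.2) (⟨i, hi⟩, j)
          simpa [f, aeval_eq_eval] using this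
    refine LinearMap.finrank_le_finrank_of_injective (f := g) fun x y hxy => ?_
    have h : (g x : MvPolynomial σ K) = g y := congrArg Subtype.val hxy
    exact Subtype.ext (Subtype.ext h)
  have h3 : Fintype.card {i // i ∉ Set.range e} + Fintype.card κ = Fintype.card ι := by
    have hle := Fintype.card_le_of_injective e he
    rw [Fintype.card_subtype_compl, ← Set.card_range_of_injective he]
    have : Fintype.card (Set.range e) ≤ Fintype.card ι := by
      rw [Set.card_range_of_injective he]; exact hle
    have h4 : Fintype.card (Set.range e) = Fintype.card {x // x ∈ Set.range e} := rfl
    omega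
  rw [Fintype.card_prod] at h1
  rw [← h3]
  nlinarith

theorem finrank_sing_equiv_le {σ' : Type*} [Finite σ] (e : σ' ≃ σ) (p : ι → σ → K) :
    Module.finrank K (sing d fun i => p i ∘ e) ≤ Module.finrank K (sing d p) := by
  let g : (sing d fun i => p i ∘ e) →ₗ[K] sing d p :=
    LinearMap.codRestrict _ ((rename e).toLinearMap ∘ₗ Submodule.subtype _) fun x => by
      refine ⟨x.2.1.rename_isHomogeneous, fun i j => ?_⟩
      obtain ⟨j, rfl⟩ := e.surjective j
      have := x.2.2 i j
      simp only [LinearMap.comp_apply, Submodule.subtype_apply, AlgHom.toLinearMap_apply]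
      rw [pderiv_rename e.injective, eval_rename]
      exact this
  refine LinearMap.finrank_le_finrank_of_injective (f := g) fun x y hxy => ?_
  exact Subtype.ext (rename_injective _ e.injective (congrArg Subtype.val hxy))

end

/-- There are `q` points imposing independent singularity conditions on degree `d` forms in
`M` variables. -/
def Ind (K : Type*) [Field K] (M d q : ℕ) : Prop :=
  ∃ p : Fin q → Fin M → K, Module.finrank K (sing d p) + q * M ≤ M.multichoose d

theorem Ind.of_fintype {K σ ι : Type*} [Field K] [Fintype σ] [Fintype ι] {M d q : ℕ}
    (p : ι → σ → K) (hM : Fintype.card σ = M) (hq : q ≤ Fintype.card ι)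
    (h : Module.finrank K (sing d p) + Fintype.card ι * M ≤ M.multichoose d) : Ind K M d q := by
  subst hM
  let e := Fintype.equivFin σ
  let k := (Fintype.equivFin ι).symm
  refine ⟨fun i j => p (k (Fin.castLE hq i)) (e.symm j), ?_⟩
  have h1 := finrank_sing_equiv_le (d := d) e.symm (p ∘ fun i : Fin q => k (Fin.castLE hq i))
  have h2 := finrank_sing_comp_le (d := d) p (fun i : Fin q => k (Fin.castLE hq i))
    (k.injective.comp (Fin.castLE_injective hq))
  rw [Fintype.card_fin] at h2
  have h3 : (fun i => (p ∘ fun i : Fin q => k (Fin.castLE hq i)) i ∘ e.symm)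
    = fun i j => p (k (Fin.castLE hq i)) (e.symm j) := rfl
  rw [h3] at h1
  omega

theorem Ind.mono {K : Type*} [Field K] {M d q q' : ℕ} (h : Ind K M d q) (hq : q' ≤ q) :
    Ind K M d q' := by
  obtain ⟨p, hp⟩ := h
  exact Ind.of_fintype p (Fintype.card_fin M) (by simpa) (by simpa)

/-- The linear map sending a polynomial to its value at a generic point. -/
def genEval {K σ ι : Type*} [Field K] (i : ι) :
    MvPolynomial σ K →ₗ[K] MvPolynomial (ι × σ) K :=
  (rename (Prod.mk i)).toLinearMap

theorem eval_genEval {K σ ι : Type*} [Field K] (i : ι) (f : MvPolynomial σ K) (x : ι × σ → K) :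
    eval x (genEval i f) = eval (fun j => x (i, j)) f := by
  simp [genEval, eval_rename]; rfl

theorem Gen.finrank_sing_le {K σ ι : Type*} [Field K] [Finite σ] [Finite ι] {d δ : ℕ}
    (p : ι → σ → K) (hp : Module.finrank K (sing d p) ≤ δ) :
    Gen fun x : ι × σ → K => Module.finrank K (sing d fun i j => x (i, j)) ≤ δ := by
  let l : ι × σ → homogeneousSubmodule σ K d →ₗ[K] MvPolynomial (ι × σ) K := fun b =>
    genEval b.1 ∘ₗ (pderiv b.2).toLinearMap ∘ₗ Submodule.subtype _
  have key (x : ι × σ → K) : Module.finrank K (kerAt l x)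
      = Module.finrank K (sing d fun i j => x (i, j)) := by
    have : (kerAt l x).map (Submodule.subtype _) = sing d fun i j => x (i, j) := by
      ext f
      simp only [Submodule.mem_map, Submodule.subtype_apply, Subtype.exists, exists_and_right,
        exists_eq_right, mem_kerAt, mem_sing]
      constructor
      · rintro ⟨h, h'⟩
        exact ⟨h, fun i j => by simpa [l, eval_genEval] using h' (i, j)⟩
      · rintro ⟨h, h'⟩
        exact ⟨h, fun b => by simpa [l, eval_genEval] using h' b.1 b.2⟩
    rw [← this]
    exact (LinearEquiv.finrank_eq (Submodule.equivMapOfInjective _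
      (Submodule.subtype_injective _) _))
  have := Gen.of_kerAt l (fun b => p b.1 b.2) (δ := δ) (by rw [key]; exact hp)
  exact this.mono fun x hx => by rwa [key] at hx

/-! ### Tensors with prescribed linear conditions -/

section
variable {K : Type*} [Field K]

def Good3 (c : ℕ) (x : Fin 3 × (Fin 3 ⊕ Fin 3) → K) (y z : Fin c × (Fin 3 ⊕ Fin c) → K) : Prop :=
  ∀ T : Fin 3 → Fin 3 → Fin c → K,
    (∀ k e, ∑ a, ∑ b, x (k, .inl a) * x (k, .inr b) * T a b e = 0) →
    (∀ k b, ∑ a, ∑ e, y (k, .inl a) * y (k, .inr e) * T a b e = 0) →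
    (∀ k a, ∑ b, ∑ e, z (k, .inl b) * z (k, .inr e) * T a b e = 0) → T = 0

def Good2 (c : ℕ) (S : Fin c → Prop) {l : ℕ} (P : Fin l → Fin 3 × Fin c × Fin c)
    (x : Fin c × (Fin 3 ⊕ Fin c) → K) : Prop :=
  ∀ (G : Fin 3 → Fin 3 → Fin c → K) (H : Fin 3 → Fin c → Fin c → K),
    (∀ a b e, G a b e = G b a e) → (∀ a b e, H a b e = H a e b) →
    (∀ a e, G a a e = 0) → (∀ a e, S e → H a e e = 0) →
    (∀ j, H (P j).1 (P j).2.1 (P j).2.2 = 0) →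
    (∀ k i, 2 * (∑ a, ∑ b, x (k, .inl a) * x (k, .inr b) * G a i b)
      + ∑ b, ∑ e, x (k, .inr b) * x (k, .inr e) * H i b e = 0) →
    (∀ k j, ∑ a, ∑ b, x (k, .inl a) * x (k, .inl b) * G a b j
      + 2 * (∑ a, ∑ b, x (k, .inl a) * x (k, .inr b) * H a b j) = 0) → G = 0 ∧ H = 0

theorem Gen.of_ker_trivial {K τ β E : Type*} [Field K] [AddCommGroup E] [Module K E]
    [FiniteDimensional K E] [Finite β] (l : β → E →ₗ[K] MvPolynomial τ K) (x₀ : τ → K)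
    (h : ∀ e, (∀ b, eval x₀ (l b e) = 0) → e = 0) :
    Gen (fun x => ∀ e, (∀ b, eval x (l b e) = 0) → e = 0) := by
  have h0 : kerAt l x₀ = ⊥ := (Submodule.eq_bot_iff _).2 fun e he => h e he
  refine (Gen.of_kerAt l x₀ (δ := 0) (by rw [h0, finrank_bot])).mono fun x hx e he => ?_
  have := Submodule.finrank_eq_zero.1 (Nat.le_zero.1 hx)
  exact (Submodule.eq_bot_iff _).1 this e he

def coord3 (α β γ : Type*) (a : α) (b : β) (c : γ) : (α → β → γ → K) →ₗ[K] K :=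
  LinearMap.proj c ∘ₗ LinearMap.proj b ∘ₗ LinearMap.proj a

theorem Good3.gen {c : ℕ} {x₀ : Fin 3 × (Fin 3 ⊕ Fin 3) → K} {y₀ z₀ : Fin c × (Fin 3 ⊕ Fin c) → K}
    (h : Good3 c x₀ y₀ z₀) :
    Gen fun x : (Fin 3 × (Fin 3 ⊕ Fin 3)) ⊕ (Fin c × (Fin 3 ⊕ Fin c)) ⊕ (Fin c × (Fin 3 ⊕ Fin c)) → K =>
      Good3 c (fun s => x (.inl s)) (fun s => x (.inr (.inl s))) (fun s => x (.inr (.inr s))) := by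
  let V := (Fin 3 × (Fin 3 ⊕ Fin 3)) ⊕ (Fin c × (Fin 3 ⊕ Fin c)) ⊕ (Fin c × (Fin 3 ⊕ Fin c))
  let l : (Fin 3 × Fin c) ⊕ (Fin c × Fin 3) ⊕ (Fin c × Fin 3) →
      (Fin 3 → Fin 3 → Fin c → K) →ₗ[K] MvPolynomial V K :=
    Sum.elim (fun s => ∑ a, ∑ b, (coord3 _ _ _ a b s.2).smulRight
        (X (.inl (s.1, .inl a)) * X (.inl (s.1, .inr b)))) <|
      Sum.elim (fun s => ∑ a, ∑ e, (coord3 _ _ _ a s.2 e).smulRight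
        (X (.inr (.inl (s.1, .inl a))) * X (.inr (.inl (s.1, .inr e)))))
      (fun s => ∑ b, ∑ e, (coord3 _ _ _ s.2 b e).smulRight
        (X (.inr (.inr (s.1, .inl b))) * X (.inr (.inr (s.1, .inr e)))))
  have key (x : V → K) (T) : (∀ b, eval x (l b T) = 0) ↔
    (∀ k e, ∑ a, ∑ b, x (.inl (k, .inl a)) * x (.inl (k, .inr b)) * T a b e = 0) ∧
    (∀ k b, ∑ a, ∑ e, x (.inr (.inl (k, .inl a))) * x (.inr (.inl (k, .inr e))) * T a b e = 0) ∧
    (∀ k a, ∑ b, ∑ e, x (.inr (.inr (k, .inl b))) * x (.inr (.inr (k, .inr e))) * T a b e = 0) := by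
    simp only [l, Sum.forall, Sum.elim_inl, Sum.elim_inr, Prod.forall, LinearMap.sum_apply,
      LinearMap.smulRight_apply, map_sum, smul_eval, map_mul, eval_X, coord3,
      LinearMap.comp_apply, LinearMap.proj_apply, mul_comm (T _ _ _)]
  refine (Gen.of_ker_trivial l (Sum.elim x₀ (Sum.elim y₀ z₀)) fun T hT => ?_).mono
    fun x hx T h1 h2 h3 => hx T ((key x T).2 ⟨h1, h2, h3⟩)
  obtain ⟨h1, h2, h3⟩ := (key _ T).1 hT
  exact h T h1 h2 h3

theorem Good2.gen {c : ℕ} {S : Fin c → Prop} {l : ℕ} {P : Fin l → Fin 3 × Fin c × Fin c}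
    {x₀ : Fin c × (Fin 3 ⊕ Fin c) → K} (h : Good2 c S P x₀) :
    Gen (Good2 (K := K) c S P) := by
  let V := Fin c × (Fin 3 ⊕ Fin c)
  let γ (a : Fin 3) (b : Fin 3) (e : Fin c) (p : MvPolynomial V K) :
      ((Fin 3 → Fin 3 → Fin c → K) × (Fin 3 → Fin c → Fin c → K)) →ₗ[K] MvPolynomial V K :=
    (coord3 _ _ _ a b e ∘ₗ LinearMap.fst _ _ _).smulRight p
  let η (a : Fin 3) (b : Fin c) (e : Fin c) (p : MvPolynomial V K) :
      ((Fin 3 → Fin 3 → Fin c → K) × (Fin 3 → Fin c → Fin c → K)) →ₗ[K] MvPolynomial V K :=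
    (coord3 _ _ _ a b e ∘ₗ LinearMap.snd _ _ _).smulRight p
  let l₁ (s : Fin 3 × Fin 3 × Fin c) := γ s.1 s.2.1 s.2.2 1 - γ s.2.1 s.1 s.2.2 1
  let l₂ (s : Fin 3 × Fin c × Fin c) := η s.1 s.2.1 s.2.2 1 - η s.1 s.2.2 s.2.1 1
  let l₃ (s : Fin 3 × Fin c) := γ s.1 s.1 s.2 1
  let l₄ (s : Fin 3 × {e // S e}) := η s.1 s.2 s.2 1
  let l₅ (j : Fin l) := η (P j).1 (P j).2.1 (P j).2.2 1
  let l₆ (s : Fin c × Fin 3) := (2 : K) • ∑ a, ∑ b, γ a s.2 b (X (s.1, .inl a) * X (s.1, .inr b))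
    + ∑ b, ∑ e, η s.2 b e (X (s.1, .inr b) * X (s.1, .inr e))
  let l₇ (s : Fin c × Fin c) := ∑ a, ∑ b, γ a b s.2 (X (s.1, .inl a) * X (s.1, .inl b))
    + (2 : K) • ∑ a, ∑ b, η a b s.2 (X (s.1, .inl a) * X (s.1, .inr b))
  let l := Sum.elim l₁ <| Sum.elim l₂ <| Sum.elim l₃ <| Sum.elim l₄ <| Sum.elim l₅ <| Sum.elim l₆ l₇
  have key (x : V → K) (T : ((Fin 3 → Fin 3 → Fin c → K) × (Fin 3 → Fin c → Fin c → K))) :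
    (∀ b, eval x (l b T) = 0) ↔
    (∀ a b e, T.1 a b e = T.1 b a e) ∧ (∀ a b e, T.2 a b e = T.2 a e b) ∧
    (∀ a e, T.1 a a e = 0) ∧ (∀ a e, S e → T.2 a e e = 0) ∧
    (∀ j, T.2 (P j).1 (P j).2.1 (P j).2.2 = 0) ∧
    (∀ k i, 2 * (∑ a, ∑ b, x (k, .inl a) * x (k, .inr b) * T.1 a i b)
      + ∑ b, ∑ e, x (k, .inr b) * x (k, .inr e) * T.2 i b e = 0) ∧
    (∀ k j, ∑ a, ∑ b, x (k, .inl a) * x (k, .inl b) * T.1 a b j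
      + 2 * (∑ a, ∑ b, x (k, .inl a) * x (k, .inr b) * T.2 a b j) = 0) := by
    simp only [l, l₁, l₂, l₃, l₄, l₅, l₆, l₇, Sum.forall,
      Sum.elim_inl, Sum.elim_inr, Prod.forall, LinearMap.sum_apply,
      LinearMap.smulRight_apply, map_sum, smul_eval, map_mul, eval_X, coord3, γ, η, Subtype.forall,
      LinearMap.comp_apply, LinearMap.proj_apply,
      LinearMap.sub_apply, LinearMap.add_apply, map_add, map_sub, map_one, one_mul, sub_eq_zero,
      LinearMap.fst_apply, LinearMap.snd_apply, LinearMap.smul_apply, mul_comm (T.1 _ _ _), mul_comm (T.2 _ _ _)]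
  have hl : Gen fun x => ∀ T, (∀ b, eval x (l b T) = 0) → T = 0 := by
    refine Gen.of_ker_trivial l x₀ fun T hT => ?_
    obtain ⟨h1, h2, h3, h4, h5, h6, h7⟩ := (key _ T).1 hT
    exact Prod.ext_iff.2 (h T.1 T.2 h1 h2 h3 h4 h5 h6 h7)
  refine hl.mono fun x hx G H h1 h2 h3 h4 h5 h6 h7 => ?_
  have := hx (G, H) ((key x (G, H)).2 ⟨h1, h2, h3, h4, h5, h6, h7⟩)
  exact Prod.mk_eq_zero.1 this

/-- Integral parameters as elements of `K`. -/
def dat (K : Type*) [Field K] {c : ℕ} (A : Fin c → Fin 3 → ℤ) (B : Fin c → Fin c → ℤ) : Fin c × (Fin 3 ⊕ Fin c) → K :=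
  fun s => Sum.elim (fun a => (A s.1 a : K)) (fun b => (B s.1 b : K)) s.2

theorem good3_four [CharZero K] : Good3 4  (dat K ![![0,0,1],![1,0,1],![0,1,0]] ![![1,0,1],![0,1,0],![0,0,1]])
   (dat K ![![0,1,1],![1,0,0],![0,1,1],![1,0,0]] ![![0,0,1,1],![0,0,1,0],![0,0,0,1],![0,0,0,1]])
   (dat K ![![0,1,1],![1,0,0],![0,1,1],![1,0,0]] ![![1,0,0,0],![1,0,0,0],![0,1,0,0],![0,1,0,0]]) := by
  intro T h1 h2 h3
  simp [Fin.forall_fin_succ, Fin.sum_univ_succ, dat] at h1 h2 h3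
  suffices ∀ a b c, T a b c = 0 by ext; simp [this]
  simp [Fin.forall_fin_succ]
  grind (splits := 60)

theorem good3_three [CharZero K] : Good3 3  (dat K ![![0,1,1],![0,1,0],![1,0,0]] ![![1,0,0],![1,0,-1],![0,0,1]])
   (dat K ![![1,0,1],![0,0,1],![1,1,0]] ![![1,0,0],![1,0,1],![-1,0,1]])
   (dat K ![![0,1,0],![0,1,0],![1,0,1]] ![![0,1,0],![0,0,1],![0,1,0]]) := by
  intro T h1 h2 h3
  simp [Fin.forall_fin_succ, Fin.sum_univ_succ, dat] at h1 h2 h3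
  suffices ∀ a b c, T a b c = 0 by ext; simp [this]
  simp [Fin.forall_fin_succ]
  grind (splits := 60)

theorem good3_two [CharZero K] : Good3 2  (dat K ![![1,0,0],![0,0,1],![0,1,0]] ![![0,1,1],![0,1,0],![1,1,0]])
   (dat K ![![1,1,0],![0,1,1]] ![![1,0],![1,0]])
   (dat K ![![1,0,0],![0,0,1]] ![![0,1],![0,1]]) := by
  intro T h1 h2 h3
  simp [Fin.forall_fin_succ, Fin.sum_univ_succ, dat] at h1 h2 h3
  suffices ∀ a b c, T a b c = 0 by ext; simp [this]
  simp [Fin.forall_fin_succ]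
  grind (splits := 60)

set_option maxHeartbeats 800000 in
theorem good2_two [CharZero K] : Good2 2  (fun e => e = 0) ![(1,0,1),(2,0,1)]
   (dat K ![![1,1,0],![1,0,1]] ![![0,1],![1,1]]) := by
  intro G H hG hH g h l h1 h2
  simp [Fin.forall_fin_succ] at h l
  have hG' (e) : G 1 0 e = G 0 1 e ∧ G 2 0 e = G 0 2 e ∧ G 2 1 e = G 1 2 e := ⟨hG .., hG .., hG ..⟩
  have hH' (a) : H a 1 0 = H a 0 1 := hH ..
  simp [Fin.forall_fin_succ, Fin.sum_univ_succ, dat, g, h, l, hG', hH'] at h1 h2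
  suffices h : (∀ a b e, G a b e = 0) ∧ ∀ a b e, H a b e = 0 by
    exact ⟨by ext; simp [h], by ext; simp [h]⟩
  simp [Fin.forall_fin_succ, g, h, l, hG', hH']
  clear hG hH hG' hH' g h l
  grind (splits := 60)

set_option maxHeartbeats 800000 in
theorem good2_three [CharZero K] : Good2 3  (fun _ => True) (l := 0) ![]
   (dat K ![![1,0,1],![-1,1,0],![0,-1,-1]] ![![1,0,1],![0,1,1],![1,1,0]]) := by
  intro G H hG hH g h l h1 h2
  simp [Fin.forall_fin_succ] at h
  have hG' (e) : G 1 0 e = G 0 1 e ∧ G 2 0 e = G 0 2 e ∧ G 2 1 e = G 1 2 e := ⟨hG .., hG .., hG ..⟩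
  have hH' (a) : H a 1 0 = H a 0 1 ∧ H a 2 0 = H a 0 2 ∧ H a 2 1 = H a 1 2 :=
    ⟨hH .., hH .., hH ..⟩
  simp [Fin.forall_fin_succ, Fin.sum_univ_succ, dat, g, h, hG', hH'] at h1 h2
  suffices h : (∀ a b e, G a b e = 0) ∧ ∀ a b e, H a b e = 0 by
    exact ⟨by ext; simp [h], by ext; simp [h]⟩
  simp [Fin.forall_fin_succ, g, h, hG', hH']
  clear hG hH hG' hH' g h l
  grind (splits := 60)

set_option maxHeartbeats 800000 in
theorem good2_four [CharZero K] : Good2 4  (fun _ => True) ![(0,0,2),(0,2,3)]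
   (dat K ![![1,0,1],![0,1,1],![1,1,0],![0,1,-1]] ![![1,0,0,1],![0,0,1,1],![0,1,1,0],![1,1,0,0]]) := by
  intro G H hG hH g h l h1 h2
  simp [Fin.forall_fin_succ] at h l
  have hG' (e) : G 1 0 e = G 0 1 e ∧ G 2 0 e = G 0 2 e ∧ G 2 1 e = G 1 2 e := ⟨hG .., hG .., hG ..⟩
  have hH' (a) : H a 1 0 = H a 0 1 ∧ H a 2 0 = H a 0 2 ∧ H a 3 0 = H a 0 3 ∧ H a 2 1 = H a 1 2 ∧
    H a 3 1 = H a 1 3 ∧ H a 3 2 = H a 2 3 := ⟨hH .., hH .., hH .., hH .., hH .., hH ..⟩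
  simp [Fin.forall_fin_succ, Fin.sum_univ_succ, dat, g, h, l, hG', hH'] at h1 h2
  suffices h : (∀ a b e, G a b e = 0) ∧ ∀ a b e, H a b e = 0 by
    exact ⟨by ext; simp [h], by ext; simp [h]⟩
  simp [Fin.forall_fin_succ, g, h, l, hG', hH']
  clear hG hH hG' hH' g h l
  grind (splits := 60)

end

/-! ### Cubics -/

section
variable {K ι : Type*} [Field K]

/-- The symmetric tensor of third derivatives at the origin. -/
def cubicTensor (f : MvPolynomial ι K) (a b c : ι) : K :=
  constantCoeff (pderiv a (pderiv b (pderiv c f)))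

theorem pderiv_comm' (a b : ι) (f : MvPolynomial ι K) :
    pderiv a (pderiv b f) = pderiv b (pderiv a f) := by
  classical
  have h : ⁅(pderiv a : Derivation K (MvPolynomial ι K) (MvPolynomial ι K)),
      (pderiv b : Derivation K (MvPolynomial ι K) (MvPolynomial ι K))⁆ = 0 := by
    apply MvPolynomial.derivation_ext
    intro i
    simp [Derivation.commutator_apply, pderiv_X, Pi.single_apply, apply_ite]
  have := congrArg (fun D => D f) h
  simpa [Derivation.commutator_apply, sub_eq_zero] using this

theorem cubicTensor_comm₁ (f : MvPolynomial ι K) (a b c : ι) :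
    cubicTensor f a b c = cubicTensor f b a c := by rw [cubicTensor, pderiv_comm', cubicTensor]

theorem cubicTensor_comm₂ (f : MvPolynomial ι K) (a b c : ι) :
    cubicTensor f a b c = cubicTensor f a c b := by
  rw [cubicTensor, pderiv_comm' b c, cubicTensor]

theorem MvPolynomial.IsHomogeneous.eq_C {h : MvPolynomial ι K} (hh : h.IsHomogeneous 0) :
    h = C (constantCoeff h) := by
  rw [← totalDegree_zero_iff_isHomogeneous, totalDegree_eq_zero_iff_eq_C] at hh
  exact hh

variable [Fintype ι]

theorem euler_eval {d : ℕ} {h : MvPolynomial ι K} (hh : h.IsHomogeneous d) (p : ι → K) :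
    ∑ a, p a * eval p (pderiv a h) = d * eval p h := by
  have := congrArg (eval p) hh.sum_X_mul_pderiv
  simpa [map_sum, smul_eval] using this

theorem cubicTensor_eval {f : MvPolynomial ι K} (hf : f.IsHomogeneous 3) (p : ι → K) (c : ι) :
    ∑ a, ∑ b, p a * p b * cubicTensor f a b c = 2 * eval p (pderiv c f) := by
  have h2 : (pderiv c f).IsHomogeneous 2 := hf.pderiv
  have h1 (b : ι) : (pderiv b (pderiv c f)).IsHomogeneous 1 := h2.pderiv
  have h0 (a b : ι) : (pderiv a (pderiv b (pderiv c f))).IsHomogeneous 0 := (h1 b).pderiv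
  have e1 (b : ι) : ∑ a, p a * cubicTensor f a b c = eval p (pderiv b (pderiv c f)) := by
    have := euler_eval (h1 b) p
    rw [Nat.cast_one, one_mul] at this
    rw [← this]
    refine Finset.sum_congr rfl fun a _ => ?_
    rw [(h0 a b).eq_C, eval_C]; rfl
  have e2 := euler_eval h2 p
  rw [Nat.cast_ofNat] at e2
  rw [← e2, Finset.sum_comm]
  refine Finset.sum_congr rfl fun b _ => ?_
  rw [← e1, Finset.mul_sum]
  exact Finset.sum_congr rfl fun a _ => by ring

theorem eq_zero_of_pderiv [CharZero K] {d : ℕ} (hd : d ≠ 0) {h : MvPolynomial ι K}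
    (hh : h.IsHomogeneous d) (h0 : ∀ a, pderiv a h = 0) : h = 0 := by
  have := hh.sum_X_mul_pderiv
  simp only [h0, mul_zero, Finset.sum_const_zero] at this
  have h2 := congrArg (fun g => (d : K)⁻¹ • g) this.symm
  simpa [← Nat.cast_smul_eq_nsmul K, smul_smul, hd] using h2

theorem cubicTensor_injective [CharZero K] {f : MvPolynomial ι K} (hf : f.IsHomogeneous 3)
    (h : ∀ a b c, cubicTensor f a b c = 0) : f = 0 := by
  refine eq_zero_of_pderiv (by decide) hf fun c => ?_
  have h2 : (pderiv c f).IsHomogeneous 2 := hf.pderiv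
  refine eq_zero_of_pderiv (by decide) h2 fun b => ?_
  have h1 : (pderiv b (pderiv c f)).IsHomogeneous 1 := h2.pderiv
  refine eq_zero_of_pderiv (by decide) h1 fun a => ?_
  have h0 : (pderiv a (pderiv b (pderiv c f))).IsHomogeneous 0 := h1.pderiv
  rw [h0.eq_C]
  have := h a b c
  rw [cubicTensor] at this
  rw [this, map_zero]

/-- A bound for the dimension of a space of singular cubics in terms of symmetric tensors. -/
theorem finrank_sing_three_le [CharZero K] {κ Λ : Type*} [Fintype Λ] (p : κ → ι → K)
    (L : Λ → ι × ι × ι)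
    (h : ∀ T : ι → ι → ι → K, (∀ a b c, T a b c = T b a c) → (∀ a b c, T a b c = T a c b) →
      (∀ i c, ∑ a, ∑ b, p i a * p i b * T a b c = 0) →
      (∀ l, T (L l).1 (L l).2.1 (L l).2.2 = 0) → ∀ a b c, T a b c = 0) :
    Module.finrank K (sing 3 p) ≤ Fintype.card Λ := by
  let g : sing 3 p →ₗ[K] (Λ → K) := LinearMap.pi fun l =>
    (aeval (0 : ι → K)).toLinearMap ∘ₗ (pderiv (L l).1).toLinearMap ∘ₗ (pderiv (L l).2.1).toLinearMap
      ∘ₗ (pderiv (L l).2.2).toLinearMap ∘ₗ Submodule.subtype _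
  have hg (x : sing 3 p) (l : Λ) : g x l = cubicTensor x.1 (L l).1 (L l).2.1 (L l).2.2 := by
    simp [g, cubicTensor, aeval_eq_eval]
  have : Function.Injective g := by
    rw [injective_iff_map_eq_zero]
    intro x hx
    refine Subtype.ext (cubicTensor_injective x.2.1 (h (cubicTensor x.1) (cubicTensor_comm₁ _)
      (cubicTensor_comm₂ _) (fun i c => ?_) fun l => ?_))
    · rw [cubicTensor_eval x.2.1, x.2.2 i c, mul_zero]
    · rw [← hg, hx]; rfl
  simpa using LinearMap.finrank_le_finrank_of_injective this

variable [DecidableEq ι]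

/-- The vector with coordinates `x` along the basis vectors indexed by `f`. -/
def push {α : Type*} [Fintype α] (f : α → ι) (x : α → K) : ι → K :=
  ∑ s, Pi.single (f s) (x s)

theorem sum_push {α : Type*} [Fintype α] (f : α → ι) (x : α → K) (g : ι → K) :
    ∑ a, push f x a * g a = ∑ s, x s * g (f s) := by
  simp only [push, Finset.sum_apply, Finset.sum_mul]
  rw [Finset.sum_comm]
  refine Finset.sum_congr rfl fun s _ => ?_
  simp [Pi.single_apply]

theorem sum_sum_push {α : Type*} [Fintype α] (f : α → ι) (x : α → K) (T : ι → ι → K) :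
    ∑ a, ∑ b, push f x a * push f x b * T a b = ∑ s, ∑ t, x s * x t * T (f s) (f t) := by
  simp only [mul_assoc, ← Finset.mul_sum]
  rw [sum_push f x (fun a => ∑ b, push f x b * T a b)]
  simp only [sum_push f x]

theorem sum_sum_push_pair {α β : Type*} [Fintype α] [Fintype β] (f : α → ι) (g : β → ι)
    (x : α ⊕ β → K) (T : ι → ι → K) (hT : ∀ a b, T a b = T b a) :
    ∑ a, ∑ b, push (Sum.elim f g) x a * push (Sum.elim f g) x b * T a b
      = ∑ s, ∑ t, x (.inl s) * x (.inl t) * T (f s) (f t)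
        + 2 * ∑ s, ∑ t, x (.inl s) * x (.inr t) * T (f s) (g t)
        + ∑ s, ∑ t, x (.inr s) * x (.inr t) * T (g s) (g t) := by
  rw [sum_sum_push]
  simp only [Fintype.sum_sum_type, Sum.elim_inl, Sum.elim_inr, Finset.sum_add_distrib]
  have : ∑ s, ∑ t, x (.inr s) * x (.inl t) * T (g s) (f t)
      = ∑ s, ∑ t, x (.inl s) * x (.inr t) * T (f s) (g t) := by
    rw [Finset.sum_comm]
    refine Finset.sum_congr rfl fun s _ => Finset.sum_congr rfl fun t _ => ?_
    rw [hT]; ring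
  rw [this]; ring

end

theorem sym_tensor_three {K : Type*} [Field K] {T : Fin 3 → Fin 3 → Fin 3 → K}
    (h1 : ∀ a b c, T a b c = T b a c) (h2 : ∀ a b c, T a b c = T a c b)
    (h : ∀ a b, T a a b = 0) (h0 : T 0 1 2 = 0) (a b c : Fin 3) : T a b c = 0 := by
  fin_cases a <;> fin_cases b <;> fin_cases c <;> simp <;> grind

section
variable {K ι : Type*} [Field K] [Fintype ι] [DecidableEq ι]

theorem sum_mul_eq_zero_of_push [CharZero K] {α β : Type*} [Fintype α] [Fintype β]
    {T : ι → ι → ι → K} (h1 : ∀ a b c, T a b c = T b a c) {f : α → ι} {g : β → ι} {x : α ⊕ β → K}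
    {e : ι} (h : ∑ a, ∑ b, push (Sum.elim f g) x a * push (Sum.elim f g) x b * T a b e = 0)
    (hf : ∀ s t, T (f s) (f t) e = 0) (hg : ∀ s t, T (g s) (g t) e = 0) :
    ∑ s, ∑ t, x (.inl s) * x (.inr t) * T (f s) (g t) e = 0 := by
  rw [sum_sum_push_pair f g x (fun a b => T a b e) fun a b => h1 a b e] at h
  simpa [hf, hg] using h

/-- The linear equations imposed on mixed entries of a symmetric tensor by the points of a pair of
blocks. -/
theorem mixed_eq_zero {c l : ℕ} {S : Fin c → Prop} {P : Fin l → Fin 3 × Fin c × Fin c}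
    {x : Fin c × (Fin 3 ⊕ Fin c) → K} (hx : Good2 c S P x)
    {T : ι → ι → ι → K} (h1 : ∀ a b c, T a b c = T b a c) (h2 : ∀ a b c, T a b c = T a c b)
    {f : Fin 3 → ι} {g : Fin c → ι}
    (hp : ∀ k e, ∑ a, ∑ b, push (Sum.elim f g) (fun s => x (k, s)) a
      * push (Sum.elim f g) (fun s => x (k, s)) b * T a b e = 0)
    (hff : ∀ a b c, T (f a) (f b) (f c) = 0) (hgg : ∀ a b c, T (g a) (g b) (g c) = 0)
    (hf : ∀ a e, T (f a) (f a) e = 0) (hg : ∀ a, S a → ∀ e, T (g a) (g a) e = 0)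
    (hP : ∀ j, T (f (P j).1) (g (P j).2.1) (g (P j).2.2) = 0) :
    (∀ a b e, T (f a) (f b) (g e) = 0) ∧ ∀ a b e, T (f a) (g b) (g e) = 0 := by
  have key (k) (e) := hp k e
  simp only [fun k e => sum_sum_push_pair f g (fun s => x (k, s)) (fun a b => T a b e)
    fun a b => h1 a b e] at key
  have h3 (a b c) : T a b c = T b c a := by rw [h1, h2]
  have := hx (fun a b e => T (f a) (f b) (g e)) (fun a b e => T (f a) (g b) (g e))
    (fun a b e => h1 _ _ _) (fun a b e => h2 _ _ _) (fun a e => hf a _)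
    (fun a e he => by rw [h3]; exact hg e he _) hP
    (fun k i => by
      have := key k (f i)
      simp only [hff, mul_zero, Finset.sum_const_zero, zero_add] at this
      rw [← this]
      simp only [h2 _ (g _) (f i), h1 (g _) (f i)])
    (fun k j => by
      have := key k (g j)
      simp only [hgg, mul_zero, Finset.sum_const_zero, add_zero] at this
      exact this)
  exact ⟨fun a b e => congrFun (congrFun (congrFun this.1 a) b) e,
    fun a b e => congrFun (congrFun (congrFun this.2 a) b) e⟩

theorem triple_eq_zero [CharZero K] {c : ℕ} {x : Fin 3 × (Fin 3 ⊕ Fin 3) → K}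
    {y z : Fin c × (Fin 3 ⊕ Fin c) → K} (hx : Good3 c x y z)
    {T : ι → ι → ι → K} (h1 : ∀ a b c, T a b c = T b a c) (h2 : ∀ a b c, T a b c = T a c b)
    {f g : Fin 3 → ι} {h : Fin c → ι}
    (hfg : ∀ k e, ∑ a, ∑ b, push (Sum.elim f g) (fun s => x (k, s)) a
      * push (Sum.elim f g) (fun s => x (k, s)) b * T a b e = 0)
    (hfh : ∀ k e, ∑ a, ∑ b, push (Sum.elim f h) (fun s => y (k, s)) a
      * push (Sum.elim f h) (fun s => y (k, s)) b * T a b e = 0)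
    (hgh : ∀ k e, ∑ a, ∑ b, push (Sum.elim g h) (fun s => z (k, s)) a
      * push (Sum.elim g h) (fun s => z (k, s)) b * T a b e = 0)
    (f1 : ∀ a b c, T (f a) (f b) (g c) = 0) (f2 : ∀ a b c, T (f a) (f b) (h c) = 0)
    (g1 : ∀ a b c, T (f a) (g b) (g c) = 0) (g2 : ∀ a b c, T (g a) (g b) (h c) = 0)
    (k1 : ∀ a b c, T (f a) (h b) (h c) = 0) (k2 : ∀ a b c, T (g a) (h b) (h c) = 0) (a b e) :
    T (f a) (g b) (h e) = 0 := by
  have h3 (a b c) : T a b c = T b c a := by rw [h1, h2]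
  have := hx (fun a b e => T (f a) (g b) (h e))
    (fun k e => sum_mul_eq_zero_of_push h1 (hfg k (h e)) (fun _ _ => f2 _ _ _) fun _ _ => g2 _ _ _)
    (fun k b => by
      simp only [h2 _ (g _) (h _)]
      exact sum_mul_eq_zero_of_push h1 (hfh k (g b)) (fun _ _ => f1 _ _ _)
        fun _ _ => by rw [← h3]; exact k2 _ _ _)
    (fun k a => by
      simp only [h3 (f a)]
      exact sum_mul_eq_zero_of_push h1 (hgh k (f a)) (fun _ _ => by rw [← h3]; exact g1 _ _ _)
        fun _ _ => by rw [← h3]; exact k1 _ _ _)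
  exact congrFun (congrFun (congrFun this a) b) e

end

theorem sum_single_single {K ι : Type*} [Field K] [Fintype ι] [DecidableEq ι] (i : ι)
    (T : ι → ι → K) :
    ∑ a, ∑ b, (Pi.single i 1 : ι → K) a * (Pi.single i 1 : ι → K) b * T a b = T i i := by
  simp [Pi.single_apply]

/-- A block decomposition of the coordinates: a symmetric tensor in `r` blocks of size `3` and one
block of size `c` vanishes as soon as it satisfies the equations given by the pairs of blocks. -/
theorem block_tensor {K : Type*} [Field K] [CharZero K] {r c l lz : ℕ} {S : Fin c → Prop}
    {P : Fin l → Fin 3 × Fin c × Fin c} {Z : Fin lz → Fin c × Fin c × Fin c}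
    {x : Fin r → Fin r → Fin 3 × (Fin 3 ⊕ Fin 3) → K} {y : Fin r → Fin c × (Fin 3 ⊕ Fin c) → K}
    (hZ : ∀ T : Fin c → Fin c → Fin c → K, (∀ a b c, T a b c = T b a c) →
      (∀ a b c, T a b c = T a c b) → (∀ a, S a → ∀ b, T a a b = 0) →
      (∀ j, T (Z j).1 (Z j).2.1 (Z j).2.2 = 0) → ∀ a b c, T a b c = 0)
    (g2 : ∀ i j, Good2 3 (fun _ => True) (l := 0) ![] (x i j))
    (g2c : ∀ i, Good2 c S P (y i))
    (g3 : ∀ i j k, i < j → j < k → Good3 3 (x i j) (x i k) (x j k))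
    (g3c : ∀ i j, i < j → Good3 c (x i j) (y i) (y j))
    {T : (Fin r × Fin 3) ⊕ Fin c → (Fin r × Fin 3) ⊕ Fin c → (Fin r × Fin 3) ⊕ Fin c → K}
    (h1 : ∀ a b c, T a b c = T b a c) (h2 : ∀ a b c, T a b c = T a c b)
    (hs : ∀ i e, T (.inl i) (.inl i) e = 0) (hz : ∀ i, S i → ∀ e, T (.inr i) (.inr i) e = 0)
    (hx : ∀ i j, i < j → ∀ k e, ∑ a, ∑ b,
      push (Sum.elim (fun a => .inl (i, a)) (fun a => .inl (j, a))) (fun s => x i j (k, s)) a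
      * push (Sum.elim (fun a => .inl (i, a)) (fun a => .inl (j, a))) (fun s => x i j (k, s)) b
      * T a b e = 0)
    (hy : ∀ i k e, ∑ a, ∑ b,
      push (Sum.elim (fun a => .inl (i, a)) .inr) (fun s => y i (k, s)) a
      * push (Sum.elim (fun a => .inl (i, a)) .inr) (fun s => y i (k, s)) b * T a b e = 0)
    (l1 : ∀ i, T (.inl (i, 0)) (.inl (i, 1)) (.inl (i, 2)) = 0)
    (l2 : ∀ j, T (.inr (Z j).1) (.inr (Z j).2.1) (.inr (Z j).2.2) = 0)
    (l3 : ∀ i j, T (.inl (i, (P j).1)) (.inr (P j).2.1) (.inr (P j).2.2) = 0) (a b e) :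
    T a b e = 0 := by
  have h3 (a b c) : T a b c = T b c a := by rw [h1, h2]
  have e1 (i a b c) : T (.inl (i, a)) (.inl (i, b)) (.inl (i, c)) = 0 :=
    sym_tensor_three (T := fun a b c => T (.inl (i, a)) (.inl (i, b)) (.inl (i, c)))
      (fun _ _ _ => h1 _ _ _) (fun _ _ _ => h2 _ _ _) (fun _ _ => hs _ _) (l1 i) a b c
  have e2 (a b c) : T (.inr a) (.inr b) (.inr c) = 0 :=
    hZ (fun a b c => T (.inr a) (.inr b) (.inr c)) (fun _ _ _ => h1 _ _ _) (fun _ _ _ => h2 _ _ _)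
      (fun a ha b => hz a ha _) l2 a b c
  have e3 (i j) (hij : i < j) := mixed_eq_zero (g2 i j) h1 h2 (hx i j hij) (e1 i) (e1 j)
    (fun a => hs _) (fun a _ => hs _) fun j => j.elim0
  have e4 (i) := mixed_eq_zero (g2c i) h1 h2 (hy i) (e1 i) e2 (fun a => hs _) (fun a ha => hz a ha)
    fun j => l3 i j
  have e5 (i j a b e) : T (.inl (i, a)) (.inl (i, b)) (.inl (j, e)) = 0 := by
    rcases lt_trichotomy i j with h | rfl | h
    · exact (e3 i j h).1 a b e
    · exact e1 i a b e
    · rw [← h3]; exact (e3 j i h).2 e a b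
  have e6 (i j) (hij : i < j) := triple_eq_zero (g3c i j hij) h1 h2 (hx i j hij) (hy i) (hy j)
    (e3 i j hij).1 (e4 i).1 (e3 i j hij).2 (e4 j).1 (e4 i).2 (e4 j).2
  have e7 (i j k) (hij : i < j) (hjk : j < k) := triple_eq_zero (g3 i j k hij hjk) h1 h2
    (hx i j hij) (hx i k (hij.trans hjk)) (hx j k hjk) (e3 i j hij).1 (e3 i k (hij.trans hjk)).1
    (e3 i j hij).2 (e3 j k hjk).1 (e3 i k (hij.trans hjk)).2 (e3 j k hjk).2
  have e8 (i j a b e) : T (.inl (i, a)) (.inl (j, b)) (.inr e) = 0 := by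
    rcases lt_trichotomy i j with h | rfl | h
    · exact e6 i j h a b e
    · exact (e4 i).1 a b e
    · rw [h1]; exact e6 j i h b a e
  have e9 (i j k a b e) : T (.inl (i, a)) (.inl (j, b)) (.inl (k, e)) = 0 := by
    rcases lt_trichotomy i j with h | rfl | h
    · rcases lt_trichotomy j k with h' | rfl | h'
      · exact e7 i j k h h' a b e
      · rw [h3]; exact e5 _ _ _ _ _
      · rcases lt_trichotomy i k with h4 | rfl | h4
        · rw [h2]; exact e7 i k j h4 h' a e b
        · rw [h2]; exact e5 _ _ _ _ _
        · rw [← h3]; exact e7 k i j h4 h _ _ _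
    · exact e5 _ _ _ _ _
    · rcases lt_trichotomy i k with h' | rfl | h'
      · rw [h1]; exact e7 j i k h h' _ _ _
      · rw [h2]; exact e5 _ _ _ _ _
      · rcases lt_trichotomy j k with h4 | rfl | h4
        · rw [h3]; exact e7 j k i h4 h' _ _ _
        · rw [h3]; exact e5 _ _ _ _ _
        · rw [h3, h1]; exact e7 k j i h4 h _ _ _
  rcases a with ⟨i, a⟩ | a <;> rcases b with ⟨j, b⟩ | b <;> rcases e with ⟨k, e⟩ | e
  · exact e9 i j k a b e
  · exact e8 i j a b e
  · rw [h2]; exact e8 i k a e b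
  · exact (e4 i).2 a b e
  · rw [h3]; exact e8 j k b e a
  · rw [h1]; exact (e4 j).2 b a e
  · rw [← h3]; exact (e4 k).2 e a b
  · exact e2 a b e

theorem six_mul_multichoose_three (M : ℕ) : 6 * M.multichoose 3 = M * (M + 1) * (M + 2) := by
  rw [Nat.multichoose_eq]
  have := Nat.descFactorial_eq_factorial_mul_choose (M + 3 - 1) 3
  simp [Nat.descFactorial, Nat.factorial] at this
  rw [show M + 3 - 1 = M + 2 by omega, ← this]; ring

theorem Ind.cubic {K : Type*} [Field K] [CharZero K] {r c l lz cs M q : ℕ} {S : Fin c → Prop}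
    [DecidablePred S] {P : Fin l → Fin 3 × Fin c × Fin c} {Z : Fin lz → Fin c × Fin c × Fin c}
    (hZ : ∀ T : Fin c → Fin c → Fin c → K, (∀ a b c, T a b c = T b a c) →
      (∀ a b c, T a b c = T a c b) → (∀ a, S a → ∀ b, T a a b = 0) →
      (∀ j, T (Z j).1 (Z j).2.1 (Z j).2.2 = 0) → ∀ a b c, T a b c = 0)
    (g2c : Fin r → Gen (Good2 (K := K) c S P))
    (g3c : Fin r → Gen fun x : (Fin 3 × (Fin 3 ⊕ Fin 3)) ⊕ (Fin c × (Fin 3 ⊕ Fin c)) ⊕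
      (Fin c × (Fin 3 ⊕ Fin c)) → K => Good3 c (fun s => x (.inl s)) (fun s => x (.inr (.inl s)))
        (fun s => x (.inr (.inr s))))
    (hS : Fintype.card {e // S e} = cs) (hM : 3 * r + c = M)
    (hq : 2 * q ≤ 3 * r + 2 * cs + 3 * r ^ 2 + 2 * r * c)
    (h : 6 * (r + lz + r * l) + 3 * (3 * r + 2 * cs + 3 * r ^ 2 + 2 * r * c) * M
      ≤ M * (M + 1) * (M + 2)) : Ind K M 3 q := by
  classical
  let V := ((Fin r × Fin r) × (Fin 3 × (Fin 3 ⊕ Fin 3))) ⊕ (Fin r × (Fin c × (Fin 3 ⊕ Fin c)))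
  have G1 : Gen fun x : V → K => ∀ i j : Fin r,
      Good2 3 (fun _ => True) (l := 0) ![] (fun s => x (.inl ((i, j), s))) :=
    Gen.all fun i => Gen.all fun j => (good2_three.gen).comap
      (f := fun s => (.inl ((i, j), s) : V)) fun a b hab => by simpa using hab
  have G2 : Gen fun x : V → K => ∀ i : Fin r, Good2 c S P (fun s => x (.inr (i, s))) :=
    Gen.all fun i => (g2c i).comap (f := fun s => (.inr (i, s) : V)) fun a b hab => by simpa using hab
  have G3 : Gen fun x : V → K => ∀ i j k : Fin r, i < j → j < k → Good3 3
      (fun s => x (.inl ((i, j), s))) (fun s => x (.inl ((i, k), s)))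
      (fun s => x (.inl ((j, k), s))) := by
    refine Gen.all fun i => Gen.all fun j => Gen.all fun k => ?_
    by_cases hij : i < j
    · by_cases hjk : j < k
      · refine (good3_three.gen.comap (f := Sum.elim (fun s => (.inl ((i, j), s) : V))
          (Sum.elim (fun s => .inl ((i, k), s)) (fun s => .inl ((j, k), s)))) ?_).mono
          fun x hx _ _ => hx
        rintro (a | a | a) (b | b | b) hab <;> simp [hij.ne, hij.ne', hjk.ne, hjk.ne'] at hab <;>
          simp [hab]
      · exact Gen.of_forall fun x _ h => absurd h hjk
    · exact Gen.of_forall fun x h => absurd h hij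
  have G4 : Gen fun x : V → K => ∀ i j : Fin r, i < j → Good3 c
      (fun s => x (.inl ((i, j), s))) (fun s => x (.inr (i, s))) (fun s => x (.inr (j, s))) := by
    refine Gen.all fun i => Gen.all fun j => ?_
    by_cases hij : i < j
    · refine ((g3c i).comap (f := Sum.elim (fun s => (.inl ((i, j), s) : V))
        (Sum.elim (fun s => .inr (i, s)) (fun s => .inr (j, s)))) ?_).mono fun x hx _ => hx
      rintro (a | a | a) (b | b | b) hab <;> simp [hij.ne, hij.ne'] at hab <;> simp [hab]
    · exact Gen.of_forall fun x h => absurd h hij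
  obtain ⟨x, ⟨h1, h2⟩, h3, h4⟩ := ((G1.and G2).and (G3.and G4)).exists_point
  let κ := (Fin r × Fin 3) ⊕ {b : Fin c // S b} ⊕ ((Σ j : Fin r, Fin j) × Fin 3) ⊕ (Fin r × Fin c)
  let p : κ → (Fin r × Fin 3) ⊕ Fin c → K :=
    Sum.elim (fun i => Pi.single (.inl i) 1) <| Sum.elim (fun i => Pi.single (.inr i.1) 1) <|
    Sum.elim (fun s => push (Sum.elim (fun a => .inl (⟨s.1.2, s.1.2.2.trans s.1.1.2⟩, a))
      (fun a => .inl (s.1.1, a))) (fun t => x (.inl ((⟨s.1.2, s.1.2.2.trans s.1.1.2⟩, s.1.1), (s.2, t)))))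
    (fun s => push (Sum.elim (fun a => .inl (s.1, a)) .inr) (fun t => x (.inr (s.1, (s.2, t)))))
  let L : Fin r ⊕ Fin lz ⊕ (Fin r × Fin l) →
      ((Fin r × Fin 3) ⊕ Fin c) × ((Fin r × Fin 3) ⊕ Fin c) × ((Fin r × Fin 3) ⊕ Fin c) :=
    Sum.elim (fun i => (.inl (i, 0), .inl (i, 1), .inl (i, 2))) <|
    Sum.elim (fun j => (.inr (Z j).1, .inr (Z j).2.1, .inr (Z j).2.2)) <|
    fun s => (.inl (s.1, (P s.2).1), .inr (P s.2).2.1, .inr (P s.2).2.2)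
  have hle : Module.finrank K (sing 3 p) ≤ _ := finrank_sing_three_le p L fun T t1 t2 ht hL => by
    refine block_tensor (P := P) (Z := Z) (x := fun i j s => x (.inl ((i, j), s)))
      (y := fun i s => x (.inr (i, s))) hZ h1 h2 h3 h4 t1 t2 (fun i e => ?_) (fun i hi e => ?_)
      (fun i j hij k e => ?_) (fun i k e => ?_) (fun i => hL (.inl i)) (fun j => hL (.inr (.inl j)))
      fun i j => hL (.inr (.inr (i, j)))
    · rw [← sum_single_single (.inl i) fun a b => T a b e]
      exact ht (.inl i) e
    · rw [← sum_single_single (.inr i) fun a b => T a b e]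
      exact ht (.inr (.inl ⟨i, hi⟩)) e
    · exact ht (.inr (.inr (.inl (⟨j, ⟨i, hij⟩⟩, k)))) e
    · exact ht (.inr (.inr (.inr (i, k)))) e
  have hsum : (∑ j : Fin r, (j : ℕ)) * 2 + r = r * r := by
    rw [Fin.sum_univ_eq_sum_range (fun j => j), Finset.sum_range_id_mul_two]
    cases r <;> simp; ring
  have hκ : 2 * Fintype.card κ = 3 * r + 2 * cs + 3 * r ^ 2 + 2 * r * c := by
    simp only [κ, Fintype.card_sum, Fintype.card_prod, Fintype.card_fin, hS, Fintype.card_sigma]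
    nlinarith
  refine Ind.of_fintype p (by simp [← hM, mul_comm]) (by omega) ?_
  have h6 := six_mul_multichoose_three M
  simp only [Fintype.card_sum, Fintype.card_prod, Fintype.card_fin] at hle
  rw [← hκ] at h
  nlinarith

/-- General singular points impose independent conditions on cubics. -/
theorem Ind.three {K : Type*} [Field K] [CharZero K] {M q : ℕ} (hM : 2 ≤ M)
    (hq : 6 * q ≤ M * (M + 2) + 5) : Ind K M 3 q := by
  obtain ⟨r, hr⟩ : ∃ r, M = 3 * r ∨ M = 3 * r + 2 ∨ M = 3 * r + 4 :=
    ⟨(M - M % 3 - if M % 3 = 1 then 3 else 0) / 3, by split_ifs <;> omega⟩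
  rcases hr with rfl | rfl | rfl
  · refine Ind.cubic (r := r) (c := 0) (l := 0) (lz := 0) (cs := 0) (S := fun _ => True) (P := ![])
      (Z := ![]) (fun T _ _ _ _ a => a.elim0) (fun _ => Good2.gen (x₀ := 0) ?_)
      (fun _ => Good3.gen (x₀ := 0) (y₀ := 0) (z₀ := 0) ?_) (by simp) (by simp) ?_ ?_
    · exact fun G H _ _ _ _ _ _ _ => ⟨by ext _ _ a; exact a.elim0, by ext _ _ a; exact a.elim0⟩
    · exact fun T _ _ _ => by ext _ _ a; exact a.elim0
    · have : 1 ≤ r := by omega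
      nlinarith
    · nlinarith
  · rcases Nat.eq_zero_or_pos r with rfl | hr
    · refine Ind.cubic (r := 0) (c := 2) (l := 0) (lz := 0) (cs := 2) (S := fun _ => True) (P := ![])
        (Z := ![]) (fun T h1 h2 h3 _ a b c => ?_) (fun j => j.elim0) (fun j => j.elim0) (by simp)
        (by simp) (by omega) (by norm_num)
      fin_cases a <;> fin_cases b <;> fin_cases c <;> simp <;> grind
    · refine Ind.cubic (r := r) (c := 2) (l := 2) (lz := 2) (cs := 1)
        (Z := ![(0, 1, 1), (1, 1, 1)]) (fun T h1 h2 h3 h a b c => ?_) (fun _ => good2_two.gen)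
        (fun _ => good3_two.gen) (by simp) (by simp) ?_ (by nlinarith)
      swap
      · rcases (show r = 1 ∨ 2 ≤ r by omega) with rfl | hr
        · omega
        · nlinarith
      have h4 := h 0
      have h5 := h 1
      simp at h4 h5
      fin_cases a <;> fin_cases b <;> fin_cases c <;> simp <;> grind
  · refine Ind.cubic (r := r) (c := 4) (l := 2) (lz := 4) (cs := 4)
      (Z := ![(0, 1, 2), (0, 1, 3), (0, 2, 3), (1, 2, 3)]) (fun T h1 h2 h3 h a b c => ?_)
      (fun _ => good2_four.gen) (fun _ => good3_four.gen) (by simp) (by simp) ?_ (by nlinarith)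
    · simp [Fin.forall_fin_succ] at h
      fin_cases a <;> fin_cases b <;> fin_cases c <;> simp <;> grind
    · rcases Nat.eq_zero_or_pos r with rfl | hr
      · omega
      · nlinarith

/-! ### Simple points -/

/-- The polynomials vanishing at the points `p i`. -/
def vanishing {K σ ι : Type*} [Field K] (p : ι → σ → K) : Submodule K (MvPolynomial σ K) where
  carrier := {f | ∀ i, eval (p i) f = 0}
  add_mem' h h' i := by simp [h i, h' i]
  zero_mem' i := by simp
  smul_mem' c f h i := by simp [smul_eval, h i]

section
variable {K σ ι : Type*} [Field K]

theorem mem_vanishing {p : ι → σ → K} {f : MvPolynomial σ K} :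
    f ∈ vanishing p ↔ ∀ i, eval (p i) f = 0 := Iff.rfl

theorem exists_finrank_inf_vanishing_le [Infinite K] (V : Submodule K (MvPolynomial σ K))
    [FiniteDimensional K V] (u : ℕ) :
    ∃ p : Fin u → σ → K, Module.finrank K ↥(V ⊓ vanishing p) ≤ Module.finrank K V - u := by
  induction u with
  | zero => exact ⟨Fin.elim0, Submodule.finrank_mono inf_le_left⟩
  | succ u ih =>
    obtain ⟨p, hp⟩ := ih
    have hf : FiniteDimensional K ↥(V ⊓ vanishing p) :=
      Submodule.finiteDimensional_of_le inf_le_left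
    by_cases h : V ⊓ vanishing p = ⊥
    · refine ⟨Fin.snoc p 0, ?_⟩
      have : V ⊓ vanishing (Fin.snoc p 0 : Fin (u + 1) → σ → K) = ⊥ := by
        rw [eq_bot_iff, ← h]
        exact inf_le_inf_left _ fun f hf i => by simpa using hf i.castSucc
      rw [this, finrank_bot]
      exact Nat.zero_le _
    · obtain ⟨f, hf1, hf2⟩ := Submodule.exists_mem_ne_zero_of_ne_bot h
      obtain ⟨x, hx⟩ : ∃ x, eval x f ≠ 0 := by
        by_contra! hne
        exact hf2 (MvPolynomial.funext fun x => by simpa using hne x)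
      refine ⟨Fin.snoc p x, ?_⟩
      have hlt : V ⊓ vanishing (Fin.snoc p x : Fin (u + 1) → σ → K) < V ⊓ vanishing p := by
        refine lt_of_le_of_ne
          (inf_le_inf_left _ fun f hf i => by simpa using hf i.castSucc) fun heq => hx ?_
        rw [← heq] at hf1
        simpa using hf1.2 (Fin.last u)
      have := Submodule.finrank_lt_finrank_of_lt hlt
      omega

theorem Gen.finrank_inf_vanishing_le [Infinite K] (V : Submodule K (MvPolynomial σ K))
    [FiniteDimensional K V] (u : ℕ) : Gen fun x : Fin u × σ → K =>
      Module.finrank K ↥(V ⊓ vanishing fun i j => x (i, j)) ≤ Module.finrank K V - u := by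
  let l : Fin u → V →ₗ[K] MvPolynomial (Fin u × σ) K := fun b => genEval b ∘ₗ V.subtype
  have key (x : Fin u × σ → K) : Module.finrank K (kerAt l x)
      = Module.finrank K ↥(V ⊓ vanishing fun i j => x (i, j)) := by
    have : (kerAt l x).map V.subtype = V ⊓ vanishing fun i j => x (i, j) := by
      ext f
      simp only [Submodule.mem_map, Submodule.subtype_apply, Subtype.exists, exists_and_right,
        exists_eq_right, mem_kerAt, Submodule.mem_inf, mem_vanishing]
      simp [l, eval_genEval]
    rw [← this]
    exact LinearEquiv.finrank_eq (Submodule.equivMapOfInjective _ V.subtype_injective _)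
  obtain ⟨p, hp⟩ := exists_finrank_inf_vanishing_le V u
  have := Gen.of_kerAt l (fun b => p b.1 b.2) (δ := Module.finrank K V - u)
    (by rw [key]; exact hp)
  exact this.mono fun x hx => by rwa [key] at hx

/-! ### Specialization to a hyperplane -/

theorem finrank_inf_ker_add_finrank_map {E F : Type*} [AddCommGroup E] [Module K E]
    [AddCommGroup F] [Module K F] (ρ : E →ₗ[K] F) (V : Submodule K E) [FiniteDimensional K V] :
    Module.finrank K ↥(V ⊓ LinearMap.ker ρ) + Module.finrank K (V.map ρ) = Module.finrank K V := by
  have h1 := (ρ.domRestrict V).finrank_range_add_finrank_ker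
  have h2 : (LinearMap.ker (ρ.domRestrict V)).map V.subtype = V ⊓ LinearMap.ker ρ := by
    ext x; simp [and_comm]
  rw [LinearMap.range_domRestrict] at h1
  rw [← h2, ← h1, add_comm]
  congr 1
  exact (LinearEquiv.finrank_eq (Submodule.equivMapOfInjective _ V.subtype_injective _)).symm

/-- Restriction of polynomials to the hyperplane where the first coordinate vanishes. -/
def restr (K : Type*) [Field K] (M : ℕ) : MvPolynomial (Fin (M + 1)) K →ₐ[K] MvPolynomial (Fin M) K :=
  aeval (Fin.cons 0 X)

theorem restr_X_zero (M : ℕ) : restr K M (X 0) = 0 := by simp [restr]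

theorem eval_restr {M : ℕ} (f : MvPolynomial (Fin (M + 1)) K) (x : Fin M → K) :
    eval x (restr K M f) = eval (Fin.cons 0 x) f := by
  have : (aeval x).comp (restr K M) = aeval (Fin.cons 0 x : Fin (M + 1) → K) := by
    apply MvPolynomial.algHom_ext
    intro i
    refine Fin.cases ?_ (fun j => ?_) i <;> simp [restr]
  simpa [aeval_eq_eval] using DFunLike.congr_fun this f

theorem pderiv_restr {M : ℕ} (f : MvPolynomial (Fin (M + 1)) K) (j : Fin M) :
    pderiv j (restr K M f) = restr K M (pderiv j.succ f) := by
  induction f using MvPolynomial.induction_on with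
  | C a => simp [restr]
  | add p q hp hq => simp [hp, hq]
  | mul_X p i hp =>
    refine Fin.cases ?_ (fun i => ?_) i
    · simp [restr_X_zero, pderiv_X, Fin.succ_ne_zero]
    · simp only [map_mul, Derivation.leibniz, smul_eq_mul, map_add, hp]
      simp [restr, pderiv_X, Pi.single_apply, apply_ite]

theorem isHomogeneous_restr {M d : ℕ} {f : MvPolynomial (Fin (M + 1)) K} (hf : f.IsHomogeneous d) :
    (restr K M f).IsHomogeneous d := by
  have := hf.aeval (Fin.cons 0 X : Fin (M + 1) → MvPolynomial (Fin M) K) (n := 1) fun i => ?_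
  · rw [one_mul] at this
    exact this
  refine Fin.cases ?_ (fun j => ?_) i
  · exact isHomogeneous_zero _ _ _
  · exact isHomogeneous_X _ _

theorem sub_aeval_mem {I : Ideal (MvPolynomial σ K)} {g : σ → MvPolynomial σ K}
    (hg : ∀ i, X i - g i ∈ I) (f : MvPolynomial σ K) : f - aeval g f ∈ I := by
  rw [← Ideal.Quotient.mk_eq_mk_iff_sub_mem]
  have : (Ideal.Quotient.mkₐ K I).comp (aeval g) = Ideal.Quotient.mkₐ K I := by
    apply MvPolynomial.algHom_ext
    intro i
    simpa using ((Ideal.Quotient.mk_eq_mk_iff_sub_mem _ _).2 (hg i)).symm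
  exact (DFunLike.congr_fun this f).symm

theorem isHomogeneous_of_X_mul {i : σ} {d : ℕ} {h : MvPolynomial σ K}
    (hh : (X i * h).IsHomogeneous (d + 1)) : h.IsHomogeneous d := by
  intro s hs
  have := hh (d := Finsupp.single i 1 + s) (by rwa [coeff_X_mul])
  rw [map_add] at this
  simp [Finsupp.weight_single] at this
  omega

theorem exists_X_zero_mul {M d : ℕ} {f : MvPolynomial (Fin (M + 1)) K}
    (hf : f.IsHomogeneous (d + 1)) (h : restr K M f = 0) :
    ∃ h : MvPolynomial (Fin (M + 1)) K, h.IsHomogeneous d ∧ f = X 0 * h := by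
  have h1 : f - aeval (Fin.cons 0 fun j => X j.succ) f ∈ Ideal.span {(X 0 : MvPolynomial (Fin (M + 1)) K)} :=
    sub_aeval_mem (fun i => Fin.cases (by simp) (fun j => by simp) i) f
  have h2 : aeval (Fin.cons 0 fun j => X j.succ) f = rename Fin.succ (restr K M f) := by
    have : aeval (Fin.cons 0 fun j => X j.succ) = (rename Fin.succ).comp (restr K M) := by
      apply MvPolynomial.algHom_ext
      intro i
      refine Fin.cases ?_ (fun j => ?_) i <;> simp [restr]
    exact DFunLike.congr_fun this f
  rw [h2, h, map_zero, sub_zero, Ideal.mem_span_singleton] at h1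
  obtain ⟨g, rfl⟩ := h1
  exact ⟨g, isHomogeneous_of_X_mul hf, rfl⟩

theorem finrank_inf_ker_restr_le {M d : ℕ} {U W : Submodule K (MvPolynomial (Fin (M + 1)) K)}
    [FiniteDimensional K W] (hU : U ≤ homogeneousSubmodule _ K (d + 1))
    (h : ∀ f, f.IsHomogeneous d → X 0 * f ∈ U → f ∈ W) :
    Module.finrank K ↥(U ⊓ LinearMap.ker (restr K M).toLinearMap) ≤ Module.finrank K W := by
  refine le_trans (Submodule.finrank_mono ?_) (Submodule.finrank_map_le (LinearMap.mulLeft K (X 0)) W)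
  rintro f ⟨hf, hf'⟩
  obtain ⟨g, hg, rfl⟩ := exists_X_zero_mul (hU hf) hf'
  exact ⟨g, h g hg hf, rfl⟩

theorem mem_sing_of_X_mul [CharZero K] [Fintype σ] {d : ℕ} {i : σ} {p : ι → σ → K}
    (hp : ∀ k, p k i ≠ 0) {h : MvPolynomial σ K} (hh : h.IsHomogeneous d)
    (hs : X i * h ∈ sing (d + 1) p) : h ∈ sing d p := by
  classical
  refine ⟨hh, fun k j => ?_⟩
  have key (j) : (if j = i then eval (p k) h else 0) + p k i * eval (p k) (pderiv j h) = 0 := by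
    have := hs.2 k j
    simp only [Derivation.leibniz, smul_eq_mul, map_add, map_mul, eval_X, pderiv_X] at this
    refine Eq.trans ?_ this
    rw [add_comm]
    congr 1
    by_cases hj : j = i
    · subst hj; simp
    · rw [if_neg hj, Pi.single_eq_of_ne (Ne.symm hj), map_zero, mul_zero]
  have e := euler_eval hh (p k)
  rw [Finset.sum_eq_single i (fun b _ hb => ?_) (by simp)] at e
  · have hi := key i
    rw [if_pos rfl, e] at hi
    have h0 : eval (p k) h = 0 := by
      have : ((d + 1 : ℕ) : K) * eval (p k) h = 0 := by rw [← hi]; push_cast; ring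
      exact (mul_eq_zero.1 this).resolve_left (by exact_mod_cast Nat.succ_ne_zero d)
    have := key j
    rw [h0, ite_self, zero_add] at this
    exact (mul_eq_zero.1 this).resolve_left (hp k)
  · have := key b
    rw [if_neg hb, zero_add] at this
    rw [(mul_eq_zero.1 this).resolve_left (hp k), mul_zero]

end

/-- Specializing `u` of the `u + k` points to a hyperplane. -/
theorem Ind.step {K : Type*} [Field K] [CharZero K] {M d u k δ : ℕ} (h1 : Ind K M (d + 2) u)
    (h2 : Ind K (M + 1) (d + 1) k)
    (h3 : ∃ p : Fin k → Fin (M + 1) → K, Module.finrank K (sing d p) ≤ δ)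
    (h : k * (M + 1) + u + δ ≤ (M + 1).multichoose (d + 1)) : Ind K (M + 1) (d + 2) (u + k) := by
  obtain ⟨p1, h1⟩ := h1
  obtain ⟨p2, h2⟩ := h2
  obtain ⟨p3, h3⟩ := h3
  obtain ⟨y, ⟨hy1, hy2⟩, hy0⟩ := (((Gen.finrank_sing_le p2 (Nat.le_sub_of_add_le h2)).and
    (Gen.finrank_sing_le p3 h3)).and (Gen.all fun i => Gen.coord_ne_zero (i, 0))).exists_point
  set V := sing (d + 1) fun i j => y (i, j) with hV
  let ρ := (restr K M).toLinearMap
  obtain ⟨x, hx1, hx2⟩ := ((Gen.finrank_sing_le p1 (Nat.le_sub_of_add_le h1)).and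
    (Gen.finrank_inf_vanishing_le (V.map ρ) u)).exists_point
  let p : Fin u ⊕ Fin k → Fin (M + 1) → K :=
    Sum.elim (fun i => Fin.cons 0 fun j => x (i, j)) fun i j => y (i, j)
  let R := V ⊓ vanishing fun i => p (.inl i)
  have : FiniteDimensional K R := Submodule.finiteDimensional_of_le inf_le_left
  have e1 : Module.finrank K ((sing (d + 2) p).map ρ) ≤ M.multichoose (d + 2) - u * M := by
    refine le_trans (Submodule.finrank_mono ?_) hx1
    rintro _ ⟨f, hf, rfl⟩
    refine ⟨isHomogeneous_restr hf.1, fun i j => ?_⟩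
    simp only [ρ, AlgHom.toLinearMap_apply]
    rw [pderiv_restr, eval_restr]
    exact hf.2 (.inl i) _
  have e2 : Module.finrank K ↥(sing (d + 2) p ⊓ LinearMap.ker ρ) ≤ Module.finrank K R := by
    refine finrank_inf_ker_restr_le (sing_le p) fun f hf hs => ⟨?_, fun i => ?_⟩
    · exact mem_sing_of_X_mul hy0 hf ⟨hs.1, fun i j => hs.2 (.inr i) j⟩
    · have := hs.2 (.inl i) 0
      simpa [Derivation.leibniz, p] using this
  have e3 : Module.finrank K (R.map ρ) ≤ Module.finrank K (V.map ρ) - u := by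
    refine le_trans (Submodule.finrank_mono ?_) hx2
    rintro _ ⟨f, hf, rfl⟩
    refine ⟨⟨f, hf.1, rfl⟩, fun i => ?_⟩
    simp only [ρ, AlgHom.toLinearMap_apply]
    rw [eval_restr]
    exact hf.2 i
  have e4 : Module.finrank K ↥(R ⊓ LinearMap.ker ρ) ≤ Module.finrank K ↥(V ⊓ LinearMap.ker ρ) :=
    Submodule.finrank_mono (inf_le_inf_right _ inf_le_left)
  have e5 : Module.finrank K ↥(V ⊓ LinearMap.ker ρ) ≤ δ :=
    (finrank_inf_ker_restr_le (sing_le _) fun f hf hs => mem_sing_of_X_mul hy0 hf hs).trans hy2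
  have f1 := finrank_inf_ker_add_finrank_map ρ (sing (d + 2) p)
  have f2 := finrank_inf_ker_add_finrank_map ρ R
  have f3 := finrank_inf_ker_add_finrank_map ρ V
  have hN := Nat.multichoose_succ_succ M (d + 1)
  refine Ind.of_fintype p (by simp) (by simp) ?_
  simp only [Fintype.card_sum, Fintype.card_fin]
  rw [show (u + k) * (M + 1) = u * M + u + k * (M + 1) by ring]
  simp only [show d + 1 + 1 = d + 2 from rfl] at hN
  omega

theorem Ind.exists_finrank_le {K : Type*} [Field K] {M d q k : ℕ} (h : Ind K M d q) (hq : q ≤ k) :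
    ∃ p : Fin k → Fin M → K, Module.finrank K (sing d p) ≤ M.multichoose d - q * M := by
  obtain ⟨p, hp⟩ := h
  refine ⟨fun i => if h : i.1 < q then p ⟨i, h⟩ else 0, le_trans (Submodule.finrank_mono
    (sing_anti _ _ fun i => ⟨Fin.castLE hq i, ?_⟩)) (Nat.le_sub_of_add_le hp)⟩
  simp

/-- In one variable a point imposes an independent condition. -/
theorem Ind.one (K : Type*) [Field K] [CharZero K] (d : ℕ) (hd : d ≠ 0) : Ind K 1 d 1 := by
  refine ⟨fun _ _ => 1, ?_⟩
  have hlt : sing d (fun (_ : Fin 1) (_ : Fin 1) => (1 : K)) < homogeneousSubmodule (Fin 1) K d := by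
    refine lt_of_le_of_ne (sing_le _) fun h => ?_
    have : (X 0 ^ d : MvPolynomial (Fin 1) K) ∈ homogeneousSubmodule (Fin 1) K d :=
      isHomogeneous_X_pow 0 d
    rw [← h] at this
    have := this.2 0 0
    simp [Derivation.leibniz_pow, hd] at this
  have := Submodule.finrank_lt_finrank_of_lt hlt
  rw [finrank_homogeneousSubmodule, Fintype.card_fin] at this
  omega

/-- General singular points on quadrics. -/
theorem exists_finrank_sing_two_le (K : Type*) [Field K] [CharZero K] {M k : ℕ} (hk : M ≤ k) :
    ∃ p : Fin k → Fin (M + 1) → K, Module.finrank K (sing 2 p) ≤ 1 := by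
  let p : Fin k → Fin (M + 1) → K :=
    fun i => if h : i.1 < M then Pi.single ⟨i, h.trans (Nat.lt_succ_self M)⟩ 1 else 0
  refine ⟨p, ?_⟩
  let L : MvPolynomial (Fin (M + 1)) K →ₗ[K] K := (aeval fun _ => (0 : K)).toLinearMap ∘ₗ
    (pderiv (Fin.last M)).toLinearMap ∘ₗ (pderiv (Fin.last M)).toLinearMap
  have hinj : Function.Injective (L ∘ₗ (sing 2 p).subtype) := by
    rw [injective_iff_map_eq_zero]
    rintro ⟨f, hf⟩ hx
    have h1 (j) : (pderiv j f).IsHomogeneous 1 := hf.1.pderiv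
    have h0 (a j) : (pderiv a (pderiv j f)).IsHomogeneous 0 := (h1 j).pderiv
    have key (a j) (ha : a ≠ Fin.last M) : pderiv a (pderiv j f) = 0 := by
      have h := euler_eval (h1 j) (Pi.single a 1)
      have ha' : a.1 < M := Fin.val_lt_last ha
      have := hf.2 ⟨a, ha'.trans_le hk⟩ j
      simp only [p, ha', dif_pos] at this
      rw [this] at h
      simp [Pi.single_apply] at h
      rw [(h0 a j).eq_C, eval_C] at h
      rw [(h0 a j).eq_C, h, C_0]
    refine Subtype.ext (eq_zero_of_pderiv (by decide) hf.1 fun j =>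
      eq_zero_of_pderiv (by decide) (h1 j) fun a => ?_)
    by_cases ha : a = Fin.last M
    · by_cases hj : j = Fin.last M
      · subst ha hj
        rw [(h0 _ _).eq_C]
        have : L f = 0 := hx
        simp only [L, LinearMap.comp_apply, AlgHom.toLinearMap_apply, Derivation.coeFn_coe] at this
        rw [(h0 _ _).eq_C, aeval_C] at this
        simp at this
        rw [this, C_0]
      · rw [pderiv_comm', key j a hj]
    · exact key a j ha
  simpa using LinearMap.finrank_le_finrank_of_injective hinj

/-! ### The number of points imposing independent conditions -/

theorem succ_mul_multichoose_succ (M d : ℕ) :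
    (d + 1) * M.multichoose (d + 1) = (M + d) * M.multichoose d := by
  cases M with
  | zero => cases d <;> simp
  | succ m =>
    have := Nat.add_one_mul_choose_eq (m + d) d
    rw [Nat.multichoose_eq, Nat.multichoose_eq, show m + 1 + (d + 1) - 1 = m + d + 1 by omega,
      show m + 1 + d - 1 = m + d by omega, show m + 1 + d = m + d + 1 by omega, this, mul_comm]

theorem multichoose_mono (M : ℕ) : Monotone (M + 1).multichoose :=
  monotone_nat_of_le_succ fun d => by rw [Nat.multichoose_succ_succ]; exact Nat.le_add_left _ _

/-- The least number of points at which `M + 1` conditions per point exceed the dimension of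
the space of forms. -/
def maxPts (M d : ℕ) : ℕ := (M.multichoose d + M) / (M + 1)

theorem maxPts_mul_le (M d : ℕ) : maxPts M d * (M + 1) ≤ M.multichoose d + M :=
  Nat.div_mul_le_self _ _

theorem le_maxPts_mul (M d : ℕ) : M.multichoose d ≤ maxPts M d * (M + 1) := by
  have := Nat.lt_div_mul_add (a := M.multichoose d + M) (b := M + 1) (by omega)
  rw [maxPts]
  omega

theorem maxPts_le_add (M d : ℕ) :
    maxPts (M + 1) (d + 1) ≤ maxPts M (d + 1) + maxPts (M + 1) d := by
  have h1 := le_maxPts_mul M (d + 1)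
  have h2 := le_maxPts_mul (M + 1) d
  have h3 := maxPts_mul_le (M + 1) (d + 1)
  rw [Nat.multichoose_succ_succ] at h3
  by_contra! h
  nlinarith

theorem maxPts_le_multichoose (M d : ℕ) : maxPts M (d + 1) ≤ M.multichoose d := by
  have h1 := maxPts_mul_le M (d + 1)
  have h2 := succ_mul_multichoose_succ M d
  by_contra! h
  have h3 : (M.multichoose d + 1) * (M + 1) ≤ maxPts M (d + 1) * (M + 1) :=
    Nat.mul_le_mul_right _ h
  have h4 : M.multichoose d < M.multichoose (d + 1) := by nlinarith
  nlinarith [Nat.zero_le (M * d * M.multichoose d)]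

theorem le_of_lt_step {M u k a b δ : ℕ} (h1 : (u + k) * (M + 2) ≤ a + b + (M + 1))
    (h2 : a ≤ u * (M + 1)) (h : b < k * (M + 1) + u + δ) :
    b * (M + 1) + (M + 1) * (M + 2) ≤ a + (M + 1) ^ 3 + δ * ((M + 1) * (M + 2)) := by
  have h3 := Nat.mul_le_mul_right ((M + 1) ^ 2) h1
  have h4 := Nat.mul_le_mul_right (M * (M + 2)) h2
  have h5 := Nat.mul_le_mul_right ((M + 1) * (M + 2)) (Nat.succ_le_of_lt h)
  zify at *
  linarith

theorem quartic_bound (M : ℕ) (hM : 1 ≤ M) {k : ℕ} (hk : k = maxPts (M + 1) 4 - maxPts M 4) :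
    M ≤ k ∧ k * (M + 1) + maxPts M 4 + 1 ≤ (M + 1).multichoose 3 := by
  have h1 := maxPts_mul_le M 4
  have h2 := le_maxPts_mul M 4
  have h3 := maxPts_mul_le (M + 1) 4
  have h4 := le_maxPts_mul (M + 1) 4
  have h5 := succ_mul_multichoose_succ (M + 1) 3
  have h6 := six_mul_multichoose_three (M + 1)
  have h7 := Nat.multichoose_succ_succ M 3
  simp only [Nat.reduceAdd] at h5 h7
  rw [h7] at h3 h4 h5
  generalize maxPts (M + 1) 4 = Q at *
  generalize maxPts M 4 = u at *
  generalize M.multichoose 4 = a at *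
  generalize (M + 1).multichoose 3 = b at *
  obtain ⟨M, rfl⟩ := Nat.exists_eq_add_of_le' hM
  have h8 : 4 * a = (M + 1) * b := by linarith
  have hMk : M + 1 + u ≤ Q := by
    by_contra! h
    have e1 : (M + 2) * b ≤ a + (M + 3) * (M * M + 3 * M + 1) := by
      have := Nat.mul_le_mul_right ((M + 2) * (M + 3)) (show Q ≤ M + u by omega)
      nlinarith [Nat.mul_le_mul_left (M + 2) h4, Nat.mul_le_mul_left (M + 3) h1]
    have e2 : (3 * M + 7) * b ≤ 4 * ((M + 3) * (M * M + 3 * M + 1)) := by linarith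
    have e3 := Nat.mul_le_mul_left (3 * M + 7) h6.ge
    nlinarith
  obtain ⟨k', rfl⟩ := Nat.exists_eq_add_of_le hMk
  have hk' : k = M + 1 + k' := by omega
  subst hk'
  refine ⟨by omega, ?_⟩
  by_contra! h
  rcases M with _ | _ | M
  · omega
  · omega
  · have e1 := le_of_lt_step (M := M + 2 + 1) (u := u) (a := a) (k := M + 2 + 1 + k') (by linarith) h2 h
    have e3 := Nat.mul_le_mul_left (3 * M + 13) h6.ge
    nlinarith

theorem multichoose_step {M D k : ℕ} (hM : 1 ≤ M) (hD : 3 ≤ D) (hex : ¬(M = 2 ∧ D = 6))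
    (hk : k = maxPts (M + 1) (D + 2) - maxPts M (D + 2))
    (hQ : maxPts (M + 1) D * (M + 1) ≤ (M + 1).multichoose D) :
    k * (M + 1) + maxPts M (D + 2)
      + ((M + 1).multichoose D - min k (maxPts (M + 1) D) * (M + 1)) ≤
      (M + 1).multichoose (D + 1) := by
  rcases le_or_gt k (maxPts (M + 1) D) with hle | hlt
  · rw [min_eq_left hle, Nat.multichoose_succ_succ]
    have h1 := maxPts_le_multichoose M (D + 1)
    have h2 : k * (M + 1) ≤ maxPts (M + 1) D * (M + 1) := Nat.mul_le_mul_right _ hle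
    have h3 : maxPts M (D + 2) ≤ M.multichoose (D + 1) := h1
    omega
  · rw [min_eq_right hlt.le]
    by_contra! h
    have h1 := maxPts_mul_le (M + 1) (D + 2)
    have h2 := le_maxPts_mul M (D + 2)
    have h3 := le_maxPts_mul (M + 1) D
    have h4 := succ_mul_multichoose_succ M (D + 1)
    have h5 := Nat.multichoose_succ_succ M D
    have h6 : (M + 1).multichoose (D + 2) = _ := Nat.multichoose_succ_succ M (D + 1)
    have hs := le_of_lt_step (a := M.multichoose (D + 2)) (b := (M + 1).multichoose (D + 1))
      (u := maxPts M (D + 2)) (k := k) (by rw [show maxPts M (D + 2) + k = maxPts (M + 1) (D + 2) by omega]; linarith)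
      h2 h
    have h7 : ((M + 1).multichoose D - maxPts (M + 1) D * (M + 1)) * (M + 2)
        ≤ (M + 1).multichoose D := by
      zify [hQ]
      zify at h3
      nlinarith
    have h8 : (M + 1) * M.multichoose (D + 1) + (M + 1) * (M + 2)
        ≤ M.multichoose (D + 2) + (M + 1) ^ 3 := by
      have := Nat.mul_le_mul_left (M + 1) h7
      rw [h5] at hs
      nlinarith
    have h4 : (D + 2) * M.multichoose (D + 2) = (M + (D + 1)) * M.multichoose (D + 1) := h4
    clear hs h7 h5 h6 h2 h1 h3
    obtain rfl | rfl | rfl | hM : M = 1 ∨ M = 2 ∨ M = 3 ∨ 4 ≤ M := by omega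
    · simp [maxPts] at hk hlt
      omega
    · simp only [Nat.multichoose_two] at h8
      obtain rfl | rfl | rfl | rfl : D = 3 ∨ D = 4 ∨ D = 5 ∨ D = 6 := by omega
      any_goals simp [maxPts, Nat.multichoose_eq, Nat.choose] at hk h; omega
    · obtain rfl | hD : D = 3 ∨ 4 ≤ D := by omega
      · simp [maxPts, Nat.multichoose_eq, Nat.choose] at hk h; omega
      · have h9 := multichoose_mono 2 (show 5 ≤ D + 1 by omega)
        have h10 : (2 + 1).multichoose 5 = 21 := by simp [Nat.multichoose_eq, Nat.choose]
        rw [h10] at h9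
        clear h hk hlt hQ
        generalize (2 + 1).multichoose (D + 1) = E at *
        generalize Nat.multichoose 3 (D + 2) = a at *
        nlinarith
    · have h9 := multichoose_mono (M - 1) (show 4 ≤ D + 1 by omega)
      rw [Nat.sub_add_cancel (by omega)] at h9
      have h10 : 24 * M.multichoose 4 = M * (M + 1) * (M + 2) * (M + 3) := by
        have e1 := six_mul_multichoose_three M
        have e2 : 4 * M.multichoose 4 = _ := succ_mul_multichoose_succ M 3
        nlinarith
      generalize M.multichoose (D + 1) = E at *
      generalize M.multichoose (D + 2) = a at *
      generalize M.multichoose 4 = b at *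
      clear h hk hlt hQ hex
      have e1 : ((D + 1) * M + 1) * E ≤ (D + 2) * ((M + 1) * (M * M + M - 1)) := by
        zify [show 1 ≤ M * M + M by nlinarith] at *
        nlinarith
      have e2 := (Nat.mul_le_mul_left ((D + 1) * M + 1) h9).trans e1
      have e3 : (D + 2) * (4 * M * b) ≤ (D + 2) * (5 * ((M + 1) * (M * M + M - 1))) := by
        nlinarith [Nat.mul_le_mul_right (M * b) (show 4 * (D + 2) ≤ 5 * (D + 1) by omega)]
      have e4 := Nat.le_of_mul_le_mul_left e3 (by omega)
      obtain ⟨M, rfl⟩ := Nat.exists_eq_add_of_le hM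
      rw [show (4 + M) * (4 + M) + (4 + M) - 1 = 19 + 9 * M + M * M by
        rw [Nat.sub_eq_iff_eq_add (by nlinarith)]; ring] at e4
      have e5 : 4 * (4 + M) * (24 * b) ≤ 24 * (5 * ((4 + M + 1) * (19 + 9 * M + M * M))) := by
        linarith
      rw [h10] at e5
      ring_nf at e5
      nlinarith [Nat.zero_le M, Nat.zero_le (M ^ 2), Nat.zero_le (M ^ 3), Nat.zero_le (M ^ 4),
        Nat.zero_le (M ^ 5)]

/-- General singular points impose independent conditions on forms of degree at least three, as
long as there are no more of them than needed to kill all forms. -/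
theorem ind_maxPts (K : Type*) [Field K] [CharZero K] : ∀ d ≥ 3, ∀ M ≥ 1, Ind K M d (maxPts M d) := by
  intro d
  induction d using Nat.strong_induction_on with
  | _ d ih =>
  intro hd M hM
  obtain rfl | ⟨d, rfl⟩ : d = 3 ∨ ∃ e, d = e + 2 + 2 := by
    obtain rfl | h := hd.eq_or_lt
    · exact .inl rfl
    · exact .inr ⟨d - 4, by omega⟩
  · obtain rfl | hM : M = 1 ∨ 2 ≤ M := by omega
    · simpa [maxPts] using Ind.one K 3 (by decide)
    · refine Ind.three hM ?_
      have h1 := maxPts_mul_le M 3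
      have h2 := six_mul_multichoose_three M
      by_contra! h
      nlinarith [Nat.mul_le_mul_right (M + 1) (Nat.succ_le_of_lt h)]
  · induction M, hM using Nat.le_induction with
    | base => simpa [maxPts] using Ind.one K (d + 2 + 2) (by omega)
    | succ M hM ihM =>
      have h1 : Ind K (M + 1) (d + 2 + 1) (maxPts (M + 1) (d + 2 + 2) - maxPts M (d + 2 + 2)) :=
        (ih (d + 3) (by omega) (by omega) (M + 1) (by omega)).mono
          (by have : maxPts (M + 1) (d + 2 + 2) ≤ maxPts M (d + 2 + 2) + maxPts (M + 1) (d + 3) :=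
                maxPts_le_add M (d + 3)
              exact Nat.sub_le_iff_le_add'.2 this)
      obtain rfl | hd : d = 0 ∨ 1 ≤ d := by omega
      · obtain ⟨h2, h3⟩ := quartic_bound M hM rfl
        exact (Ind.step ihM h1 (exists_finrank_sing_two_le K h2) h3).mono (by omega)
      · by_cases hex : M = 2 ∧ d + 2 = 6
        · obtain ⟨rfl, hd⟩ := hex
          obtain rfl : d = 4 := by omega
          have i1 : Ind K 2 6 3 := by
            simpa [maxPts, Nat.multichoose_eq, Nat.choose] using ih 6 (by omega) (by omega) 2 (by omega)
          have i2 : Ind K 2 7 3 := by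
            simpa [maxPts, Nat.multichoose_eq, Nat.choose] using ih 7 (by omega) (by omega) 2 (by omega)
          have i3 : Ind K 2 8 (1 + 3) := (Ind.one K 8 (by decide)).step i2
            (i1.exists_finrank_le le_rfl) (by simp [Nat.multichoose_eq])
          have i4 : Ind K 3 6 7 := by
            simpa [maxPts, Nat.multichoose_eq, Nat.choose] using ih 6 (by omega) (by omega) 3 (by omega)
          have i5 : Ind K 3 7 9 := by
            simpa [maxPts, Nat.multichoose_eq, Nat.choose] using ih 7 (by omega) (by omega) 3 (by omega)
          have i6 : Ind K 3 8 (4 + 8) := i3.step (i5.mono (by decide))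
            (i4.exists_finrank_le (k := 8) (by decide)) (by simp [Nat.multichoose_eq, Nat.choose])
          simpa [maxPts, Nat.multichoose_eq, Nat.choose] using i6
        · have h2 := ih (d + 2) (by omega) (by omega) (M + 1) (by omega)
          refine (Ind.step ihM h1 ((h2.mono (min_le_right _ _)).exists_finrank_le (min_le_left _ _))
            (multichoose_step hM (by omega) hex rfl ?_)).mono (by omega)
          obtain ⟨p, hp⟩ := h2
          omega

theorem exists_finrank_sing_le (K : Type*) [Field K] [CharZero K] {d M : ℕ} (hd : 3 ≤ d)
    (hM : 1 ≤ M) (q : ℕ) : ∃ p : Fin q → Fin M → K,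
      Module.finrank K (sing d p) ≤ max (M.multichoose d - q * M) q := by
  have h := ind_maxPts K d hd M hM
  rcases le_total q (maxPts M d) with hq | hq
  · obtain ⟨p, hp⟩ := h.mono hq
    exact ⟨p, le_max_of_le_left (Nat.le_sub_of_add_le hp)⟩
  · obtain ⟨p, hp⟩ := h.exists_finrank_le hq
    refine ⟨p, le_max_of_le_right (hp.trans ?_)⟩
    have := le_maxPts_mul M d
    rw [mul_add_one] at this
    omega

/-! ### The special configuration -/

theorem finrank_kerAt_comp_subtype {K τ β E : Type*} [Field K] [AddCommGroup E] [Module K E]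
    (V : Submodule K E) (l : β → E →ₗ[K] MvPolynomial τ K) (x : τ → K) :
    Module.finrank K (kerAt (fun b => l b ∘ₗ V.subtype) x) = Module.finrank K ↥(V ⊓ kerAt l x) := by
  have : (kerAt (fun b => l b ∘ₗ V.subtype) x).map V.subtype = V ⊓ kerAt l x := by
    ext f
    simp [mem_kerAt, and_comm]
  rw [← this]
  exact LinearEquiv.finrank_eq (Submodule.equivMapOfInjective _ V.subtype_injective _)

theorem Gen.finrank_sing_inf_vanishing_le {K σ ι β : Type*} [Field K] [Finite σ] [Finite ι]
    [Finite β] {d δ : ℕ} (p : ι → σ → K) (p' : β → σ → K)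
    (hp : Module.finrank K ↥(sing d p ⊓ vanishing p') ≤ δ) :
    Gen fun x : (ι ⊕ β) × σ → K =>
      Module.finrank K ↥(sing d (fun i j => x (.inl i, j)) ⊓ vanishing fun i j => x (.inr i, j)) ≤ δ := by
  let l : ι × σ ⊕ β → MvPolynomial σ K →ₗ[K] MvPolynomial ((ι ⊕ β) × σ) K :=
    Sum.elim (fun b => genEval (.inl b.1) ∘ₗ (pderiv b.2).toLinearMap) fun b => genEval (.inr b)
  have key (x : (ι ⊕ β) × σ → K) : homogeneousSubmodule σ K d ⊓ kerAt l x
      = sing d (fun i j => x (.inl i, j)) ⊓ vanishing fun i j => x (.inr i, j) := by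
    ext f
    simp [mem_kerAt, mem_sing, mem_vanishing, l, eval_genEval, and_assoc]
  have := Gen.of_kerAt (fun b => l b ∘ₗ (homogeneousSubmodule σ K d).subtype)
    (fun b => Sum.elim p p' b.1 b.2) (δ := δ) (by
      rw [finrank_kerAt_comp_subtype, key]; exact hp)
  exact this.mono fun x hx => by rwa [finrank_kerAt_comp_subtype, key] at hx

theorem exists_finrank_sing_inf_vanishing_le (K : Type*) [Field K] [CharZero K] {d M : ℕ}
    (hd : 3 ≤ d) (hM : 1 ≤ M) {q u : ℕ} (hu : q ≤ u) :
    ∃ (p : Fin q → Fin M → K) (p' : Fin u → Fin M → K),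
      Module.finrank K ↥(sing d p ⊓ vanishing p') ≤ M.multichoose d - (q * M + u) := by
  obtain ⟨p, hp⟩ := exists_finrank_sing_le K hd hM q
  obtain ⟨p', hp'⟩ := exists_finrank_inf_vanishing_le (sing d p) u
  exact ⟨p, p', by omega⟩

theorem vanishing_anti {K σ ι κ : Type*} [Field K] {p : ι → σ → K} {q : κ → σ → K}
    (h : ∀ k, ∃ i, q k = p i) : vanishing p ≤ vanishing q := fun f hf k => by
  obtain ⟨i, hi⟩ := h k
  rw [hi]; exact hf i

/-- The points of group `k` in a configuration, followed by all other points. -/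
def groupFirst {κ Q T : Type*} (k : κ) : Q ⊕ ({k' // k' ≠ k} × Q ⊕ T) → κ × Q ⊕ T :=
  Sum.elim (fun i => .inl (k, i)) (Sum.elim (fun a => .inl (a.1, a.2)) .inr)

theorem groupFirst_injective {κ Q T : Type*} (k : κ) :
    Function.Injective (groupFirst (Q := Q) (T := T) k) := by
  rintro (i | ⟨⟨k', h⟩, i⟩ | t) (i' | ⟨⟨k'', h'⟩, i'⟩ | t') <;> simp [groupFirst, *, Ne.symm]

/-- A configuration of points such that, for each group of points, the forms singular along that
group and vanishing at all other points form a space of the expected dimension. -/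
theorem exists_config (K : Type*) [Field K] [CharZero K] {d M n q t : ℕ} (hd : 3 ≤ d)
    (hM : 1 ≤ M) (hn : 1 ≤ n) (z : Fin M) :
    ∃ η : Option (Fin n) × Fin q ⊕ Fin t → Fin M → K, (∀ a, η a z ≠ 0) ∧
      ∀ k, Module.finrank K ↥(sing d (fun i => η (.inl (k, i))) ⊓ vanishing η)
        ≤ M.multichoose d - (q * M + (n * q + t)) := by
  have h (k : Option (Fin n)) : Gen fun x : (Option (Fin n) × Fin q ⊕ Fin t) × Fin M → K =>
      Module.finrank K ↥(sing d (fun i j => x (.inl (k, i), j)) ⊓ vanishing fun a j => x (a, j))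
        ≤ M.multichoose d - (q * M + (n * q + t)) := by
    obtain ⟨p, p', hp⟩ := exists_finrank_sing_inf_vanishing_le K hd hM
      (show q ≤ n * q + t by nlinarith)
    let e : {k' // k' ≠ k} × Fin q ⊕ Fin t ≃ Fin (n * q + t) :=
      Fintype.equivFinOfCardEq (by simp)
    have h1 := Gen.finrank_sing_inf_vanishing_le p (p' ∘ e)
      ((Submodule.finrank_mono (inf_le_inf_left _
        (vanishing_anti fun i => ⟨e.symm i, by simp⟩))).trans hp)
    refine (h1.comap (f := Prod.map (groupFirst k) id)
      ((groupFirst_injective k).prodMap Function.injective_id)).mono fun x hx =>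
      (Submodule.finrank_mono ?_).trans hx
    exact inf_le_inf_left _ (vanishing_anti fun _ => ⟨_, rfl⟩)
  obtain ⟨x, hx⟩ := ((Gen.all fun a => Gen.coord_ne_zero (K := K)
    ((a, z) : (Option (Fin n) × Fin q ⊕ Fin t) × Fin M)).and (Gen.all h)).exists_point
  exact ⟨fun a j => x (a, j), hx⟩

/-! ### Forms of bidegree one along the fibres -/

section
variable {K ι J : Type*} [Field K] {d : ℕ}

theorem pderiv_inl_rename_inr (i : ι) (f : MvPolynomial J K) :
    pderiv (Sum.inl i : ι ⊕ J) (rename .inr f) = 0 := by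
  classical
  refine pderiv_eq_zero_of_notMem_vars fun h => ?_
  have := vars_rename (Sum.inr : J → ι ⊕ J) f h
  simp at this

variable [Fintype ι]

/-- The form `∑ xᵢ Bᵢ(y) + y_z B(y)` in two groups of variables `x`, `y`. -/
def fibreForm (z : J) (d : ℕ) :
    (Option ι → homogeneousSubmodule J K d) →ₗ[K] MvPolynomial (ι ⊕ J) K :=
  ∑ k : Option ι, LinearMap.mulLeft K (X (k.elim (.inr z) .inl)) ∘ₗ (rename .inr).toLinearMap ∘ₗ
    Submodule.subtype _ ∘ₗ LinearMap.proj k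

theorem fibreForm_apply (z : J) (B : Option ι → homogeneousSubmodule J K d) :
    fibreForm z d B = X (.inr z) * rename .inr (B none).1
      + ∑ i, X (.inl i) * rename .inr (B (some i)).1 := by
  simp [fibreForm, LinearMap.sum_apply, Fintype.sum_option]

theorem eval_fibreForm (z : J) (B : Option ι → homogeneousSubmodule J K d) (v : ι ⊕ J → K) :
    eval v (fibreForm z d B) = v (.inr z) * eval (fun j => v (.inr j)) (B none).1
      + ∑ i, v (.inl i) * eval (fun j => v (.inr j)) (B (some i)).1 := by
  simp only [fibreForm_apply, map_add, map_mul, map_sum, eval_X, eval_rename]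
  rfl

theorem pderiv_inl_fibreForm (z : J) (B : Option ι → homogeneousSubmodule J K d) (i : ι) :
    pderiv (.inl i) (fibreForm z d B) = rename .inr (B (some i)).1 := by
  classical
  simp [fibreForm_apply, Derivation.leibniz, pderiv_inl_rename_inr, pderiv_X, Pi.single_apply]

theorem pderiv_inr_fibreForm [DecidableEq J] (z : J) (B : Option ι → homogeneousSubmodule J K d)
    (j : J) : pderiv (.inr j) (fibreForm z d B) = (if j = z then rename .inr (B none).1 else 0)
      + X (.inr z) * rename .inr (pderiv j (B none).1)
      + ∑ i, X (.inl i) * rename .inr (pderiv j (B (some i)).1) := by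
  classical
  simp [fibreForm_apply, Derivation.leibniz, pderiv_rename Sum.inr_injective, pderiv_X,
    Pi.single_apply, add_comm, eq_comm]

theorem isHomogeneous_fibreForm (z : J) (B : Option ι → homogeneousSubmodule J K d) :
    (fibreForm z d B).IsHomogeneous (d + 1) := by
  rw [fibreForm_apply, add_comm d]
  exact .add ((isHomogeneous_X _ _).mul (B none).2.rename_isHomogeneous)
    (.sum _ _ _ fun i _ => (isHomogeneous_X _ _).mul (B (some i)).2.rename_isHomogeneous)

theorem fibreForm_injective (z : J) :
    Function.Injective (fibreForm z d : (Option ι → homogeneousSubmodule J K d) →ₗ[K] _) := by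
  rw [← LinearMap.ker_eq_bot, LinearMap.ker_eq_bot']
  intro B hB
  have h1 (i) : (B (some i)).1 = 0 := by
    have := pderiv_inl_fibreForm z B i
    rw [hB, map_zero] at this
    exact rename_injective _ Sum.inr_injective (by simpa using this.symm)
  have h2 : (B none).1 = 0 := by
    rw [fibreForm_apply] at hB
    simp only [h1, map_zero, mul_zero, Finset.sum_const_zero, add_zero] at hB
    exact rename_injective _ Sum.inr_injective
      (by simpa using (mul_eq_zero.1 hB).resolve_left (X_ne_zero _))
  funext k
  rcases k with _ | i
  · exact Subtype.ext h2
  · exact Subtype.ext (h1 i)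

/-- The conditions for a fibre form to be singular at points of a first family, and for its
coefficients to vanish at points of a second family. -/
def conds (K ι : Type*) {J : Type*} [Field K] [Fintype ι] (S T : Type*) (z : J) (d : ℕ) :
    S × (ι ⊕ J) ⊕ T × Option ι → (Option ι → homogeneousSubmodule J K d) →ₗ[K]
      MvPolynomial ((S ⊕ T) × (ι ⊕ J)) K :=
  Sum.elim (fun b => genEval (.inl b.1) ∘ₗ (pderiv b.2).toLinearMap ∘ₗ fibreForm z d)
    fun b => genEval (.inr b.1) ∘ₗ (rename .inr).toLinearMap ∘ₗ Submodule.subtype _ ∘ₗ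
      LinearMap.proj b.2

theorem mem_kerAt_conds {S T : Type*} {z : J} {x : (S ⊕ T) × (ι ⊕ J) → K}
    {B : Option ι → homogeneousSubmodule J K d} : B ∈ kerAt (conds K ι S T z d) x ↔
      (∀ i c, eval (fun c' => x (.inl i, c')) (pderiv c (fibreForm z d B)) = 0) ∧
      ∀ i k, eval (fun j => x (.inr i, .inr j)) (B k).1 = 0 := by
  simp only [mem_kerAt, conds, Sum.forall, Prod.forall, Sum.elim_inl, Sum.elim_inr,
    LinearMap.comp_apply, eval_genEval, LinearMap.proj_apply, Submodule.subtype_apply,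
    AlgHom.toLinearMap_apply, eval_rename, Derivation.coeFn_coe]
  rfl

theorem finrank_le_finrank_kerAt_add {K τ β E : Type*} [Field K] [AddCommGroup E] [Module K E]
    [FiniteDimensional K E] [Fintype β] (l : β → E →ₗ[K] MvPolynomial τ K) (x : τ → K) :
    Module.finrank K E ≤ Module.finrank K (kerAt l x) + Fintype.card β := by
  let f : E →ₗ[K] (β → K) := LinearMap.pi fun b => (aeval x).toLinearMap ∘ₗ l b
  have : LinearMap.ker f = kerAt l x := by
    ext e
    simp [f, mem_kerAt, funext_iff, aeval_eq_eval]
  rw [← this]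
  exact finrank_le_finrank_ker_add f

theorem finrank_fibre [Fintype J] :
    Module.finrank K (Option ι → homogeneousSubmodule J K d)
      = (Fintype.card ι + 1) * (Fintype.card J).multichoose d := by
  rw [Module.finrank_pi_fintype]
  simp [finrank_homogeneousSubmodule]

/-- The dimension bound at the special configuration, whose points lie on the coordinate
subspaces `x = 0` and `x = y_z eᵢ`. -/
theorem finrank_kerAt_conds_special_le [CharZero K] [Fintype J] [DecidableEq ι] {Q T : Type*} (z : J)
    (η : Option ι × Q ⊕ T → J → K) (hη : ∀ a, η a z ≠ 0)
    (x : ((Option ι × Q) ⊕ T) × (ι ⊕ J) → K) (hy : ∀ a j, x (a, .inr j) = η a j)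
    (hx : ∀ k i l, x (.inl (k, i), .inl l) = if k = some l then η (.inl (k, i)) z else 0) :
    Module.finrank K (kerAt (conds K ι (Option ι × Q) T z d) x)
      ≤ ∑ k, Module.finrank K ↥(sing d (fun i => η (.inl (k, i))) ⊓ vanishing η) := by
  classical
  have hy' (a) : (fun c => x (a, c)) ∘ Sum.inr = η a := funext fun j => hy a j
  have key : ∀ B ∈ kerAt (conds K ι (Option ι × Q) T z d) x,
      (∀ k a, eval (η a) (B k).1 = 0) ∧ ∀ k i j, eval (η (.inl (k, i)))
        (pderiv j ((B none).1 + k.elim 0 fun k' => (B (some k')).1)) = 0 := by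
    intro B hB
    rw [mem_kerAt_conds] at hB
    obtain ⟨h1, h2⟩ := hB
    have h3 (s k) : eval (η (.inl s)) (B (some k)).1 = 0 := by
      have := h1 s (.inl k)
      rwa [pderiv_inl_fibreForm, eval_rename, hy'] at this
    have h4 (k : Option ι) (i j) : (if j = z then eval (η (.inl (k, i))) (B none).1 else 0)
        + η (.inl (k, i)) z * eval (η (.inl (k, i)))
          (pderiv j ((B none).1 + k.elim 0 fun k' => (B (some k')).1)) = 0 := by
      have := h1 (k, i) (.inr j)
      rw [pderiv_inr_fibreForm] at this
      simp only [map_add, map_mul, map_sum, eval_X, eval_rename, apply_ite (eval _), map_zero, hy',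
        hx, hy, ite_mul, zero_mul] at this
      refine Eq.trans ?_ this
      rcases k with _ | k
      · simp only [Option.elim_none, reduceCtorEq, if_false, Finset.sum_const_zero, add_zero]
      · simp only [Option.elim_some, map_add, Option.some.injEq, Finset.sum_ite_eq,
          Finset.mem_univ, if_true, mul_add, add_assoc]
    have h5 (k : Option ι) (i) : eval (η (.inl (k, i))) (B none).1 = 0 := by
      have hC : ((B none).1 + k.elim 0 fun k' => (B (some k')).1).IsHomogeneous d := by
        refine (B none).2.add ?_
        rcases k with _ | k
        · exact isHomogeneous_zero _ _ _
        · exact (B (some k)).2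
      have h6 := euler_eval hC (η (.inl (k, i)))
      have h7 : eval (η (.inl (k, i))) (k.elim 0 fun k' => (B (some k')).1) = 0 := by
        rcases k with _ | k
        · simp
        · exact h3 _ k
      rw [map_add, h7, add_zero] at h6
      have h8 : ∑ j, η (.inl (k, i)) j * ((if j = z then eval (η (.inl (k, i))) (B none).1 else 0)
        + η (.inl (k, i)) z * eval (η (.inl (k, i)))
          (pderiv j ((B none).1 + k.elim 0 fun k' => (B (some k')).1))) = 0 := by
        simp only [h4, mul_zero, Finset.sum_const_zero]
      simp only [mul_add, Finset.sum_add_distrib, mul_left_comm _ (η (.inl (k, i)) z)] at h8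
      rw [← Finset.mul_sum, h6] at h8
      have h9 : η (.inl (k, i)) z * ((d + 1 : ℕ) * eval (η (.inl (k, i))) (B none).1) = 0 := by
        rw [← h8, mul_left_comm]
        simp only [mul_ite, mul_zero, Finset.sum_ite_eq', Finset.mem_univ, if_true]
        push_cast
        ring
      exact (mul_eq_zero.1 ((mul_eq_zero.1 h9).resolve_left (hη _))).resolve_left
        (Nat.cast_ne_zero.2 d.succ_ne_zero)
    refine ⟨fun k a => ?_, fun k i j => ?_⟩
    · rcases a with ⟨k', i⟩ | t
      · rcases k with _ | k
        · exact h5 _ _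
        · exact h3 _ _
      · exact (congrArg (eval · (B k).1) (funext fun j => hy _ j)).symm.trans (h2 t k)
    · have := h4 k i j
      rw [h5, ite_self, zero_add] at this
      exact (mul_eq_zero.1 this).resolve_left (hη _)
  let C (B : Option ι → homogeneousSubmodule J K d) (k : Option ι) : MvPolynomial J K :=
    (B none).1 + k.elim 0 fun k' => (B (some k')).1
  let f : kerAt (conds K ι (Option ι × Q) T z d) x →ₗ[K]
      ∀ k, ↥(sing d (fun i => η (.inl (k, i))) ⊓ vanishing η) :=
    { toFun B k := ⟨C B.1 k, ⟨by
          refine (B.1 none).2.add ?_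
          rcases k with _ | k
          · exact isHomogeneous_zero _ _ _
          · exact (B.1 (some k)).2, (key B.1 B.2).2 k⟩, fun a => by
          rcases k with _ | k <;> simp [C, (key B.1 B.2).1]⟩
      map_add' B B' := by
        funext k
        rcases k with _ | k <;> exact Subtype.ext (by simp [C, add_add_add_comm])
      map_smul' c B := by
        funext k
        rcases k with _ | k <;> exact Subtype.ext (by simp [C]) }
  have hf : Function.Injective f := by
    intro B B' hB
    have h1 (k) : C B.1 k = C B'.1 k := congrArg Subtype.val (congrFun hB k)
    have h2 : (B.1 none).1 = (B'.1 none).1 := by simpa [C] using h1 none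
    refine Subtype.ext (funext fun k => Subtype.ext ?_)
    rcases k with _ | k
    · exact h2
    · simpa [C, h2] using h1 (some k)
  exact (LinearMap.finrank_le_finrank_of_injective hf).trans_eq (Module.finrank_pi_fintype K)

theorem exists_finrank_kerAt_conds_le (K : Type*) [Field K] [CharZero K] {d M n q t : ℕ}
    (hd : 3 ≤ d) (hM : 1 ≤ M) (hn : 1 ≤ n) (z : Fin M) :
    ∃ x, Module.finrank K (kerAt (conds K (Fin n) (Option (Fin n) × Fin q) (Fin t) z d) x)
      ≤ (n + 1) * (M.multichoose d - (q * M + (n * q + t))) := by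
  obtain ⟨η, h1, h2⟩ := exists_config K (q := q) (t := t) hd hM hn z
  let x : ((Option (Fin n) × Fin q) ⊕ Fin t) × (Fin n ⊕ Fin M) → K
    | (a, .inr j) => η a j
    | (.inl (k, i), .inl l) => if k = some l then η (.inl (k, i)) z else 0
    | (.inr _, .inl _) => 0
  refine ⟨x, (finrank_kerAt_conds_special_le z η h1 x (fun _ _ => rfl) fun _ _ _ => rfl).trans ?_⟩
  refine (Finset.sum_le_card_nsmul _ _ _ fun k _ => h2 k).trans_eq ?_
  simp
end

/-! ### Ideals of linear subspaces -/

section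
variable {K : Type} [Field K] {σ : Type}

theorem mem_linIdeal {S : Set (σ → K)} {f : MvPolynomial σ K} (hf : f.IsHomogeneous 1)
    (h : ∀ x ∈ S, eval x f = 0) : f ∈ linIdeal K S :=
  Ideal.subset_span ⟨hf, h⟩

theorem exists_eq_sum_X [Fintype σ] {f : MvPolynomial σ K} (hf : f.IsHomogeneous 1) :
    ∃ c : σ → K, f = ∑ j, C (c j) * X j := by
  refine ⟨fun j => constantCoeff (pderiv j f), ?_⟩
  have h := hf.sum_X_mul_pderiv
  rw [one_smul] at h
  conv_lhs => rw [← h]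
  refine Finset.sum_congr rfl fun j _ => ?_
  have h0 : (pderiv j f).IsHomogeneous 0 := hf.pderiv
  rw [mul_comm, ← h0.eq_C]

theorem eval_eq_zero_of_mem_linIdeal [Finite σ] {S : Set (σ → K)} {f : MvPolynomial σ K}
    (hf : f ∈ linIdeal K S) {v : σ → K} (hv : v ∈ Submodule.span K S) : eval v f = 0 := by
  have := Fintype.ofFinite σ
  suffices h : linIdeal K S ≤ RingHom.ker (eval v) from h hf
  refine Ideal.span_le.2 fun g ⟨hg, h⟩ => ?_
  obtain ⟨c, rfl⟩ := exists_eq_sum_X hg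
  change eval v _ = 0
  simp only [map_sum, map_mul, eval_C, eval_X] at h ⊢
  induction hv using Submodule.span_induction with
  | mem x hx => exact h x hx
  | zero => simp
  | add x y _ _ hx hy => simp only [Pi.add_apply, mul_add, Finset.sum_add_distrib, hx, hy, add_zero]
  | smul a x _ hx =>
    simp only [Pi.smul_apply, smul_eq_mul, mul_left_comm _ a, ← Finset.mul_sum, hx, mul_zero]

theorem pderiv_mem_pow {I : Ideal (MvPolynomial σ K)} {i : σ}
    (hI : ∀ f ∈ I, pderiv i f ∈ I) (k : ℕ) {f : MvPolynomial σ K} (hf : f ∈ I ^ k) :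
    pderiv i f ∈ I ^ k := by
  induction k generalizing f with
  | zero => simp
  | succ k ih =>
    rw [pow_succ] at hf ⊢
    induction hf using Submodule.mul_induction_on' with
    | mem_mul_mem a ha b hb =>
      rw [Derivation.leibniz]
      rw [smul_eq_mul, smul_eq_mul, mul_comm b]
      exact Ideal.add_mem _ (Ideal.mul_mem_mul ha (hI b hb)) (Ideal.mul_mem_mul (ih ha) hb)
    | add a _ b _ ha hb => rw [map_add]; exact Ideal.add_mem _ ha hb

theorem eval_pderiv_of_mem_sq {I : Ideal (MvPolynomial σ K)} {p : σ → K}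
    (hI : ∀ f ∈ I, eval p f = 0) {f : MvPolynomial σ K} (hf : f ∈ I ^ 2) (i : σ) :
    eval p (pderiv i f) = 0 := by
  rw [sq] at hf
  induction hf using Submodule.mul_induction_on' with
  | mem_mul_mem a ha b hb => simp [Derivation.leibniz, hI a ha, hI b hb]
  | add a _ b _ ha hb => simp [ha, hb]

/-- First order Taylor expansion. -/
theorem taylor_mem_sq [Fintype σ] {I : Ideal (MvPolynomial σ K)} {a : σ → MvPolynomial σ K}
    (ha : ∀ j, X j - a j ∈ I) (f : MvPolynomial σ K) :
    f - aeval a f - ∑ j, (X j - a j) * aeval a (pderiv j f) ∈ I ^ 2 := by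
  classical
  induction f using MvPolynomial.induction_on with
  | C c => simp
  | add f g hf hg =>
    convert Ideal.add_mem _ hf hg using 1
    simp only [map_add, mul_add, Finset.sum_add_distrib]
    ring
  | mul_X f k hf =>
    have h1 := Ideal.mul_mem_left _ (a k) hf
    have h2 : (X k - a k) * (f - aeval a f) ∈ I ^ 2 := by
      rw [sq]; exact Ideal.mul_mem_mul (ha k) (sub_aeval_mem ha f)
    convert Ideal.add_mem _ h1 h2 using 1
    have : ∑ j, (X j - a j) * aeval a (pderiv j (f * X k))
        = (X k - a k) * aeval a f + a k * ∑ j, (X j - a j) * aeval a (pderiv j f) := by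
      simp only [Derivation.leibniz, pderiv_X, smul_eq_mul, map_add, map_mul, aeval_X, mul_add,
        Finset.sum_add_distrib, Finset.mul_sum, Pi.single_apply]
      congr 1
      · simp [mul_ite]
      · exact Finset.sum_congr rfl fun j _ => by ring
    rw [this, map_mul, aeval_X]
    ring

theorem aeval_C_mul_eq_zero [Infinite K] {k : ℕ} {f : MvPolynomial σ K} (hf : f.IsHomogeneous k)
    {p : σ → K} (h : eval p f = 0) (l : MvPolynomial σ K) :
    aeval (fun j => C (p j) * l) f = 0 := by
  refine MvPolynomial.funext fun v => ?_
  have : ∀ f : MvPolynomial σ K, f.IsHomogeneous k →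
      eval v (aeval (fun j => C (p j) * l) f) = eval v l ^ k * eval p f := by
    intro f hf
    rw [f.as_sum]
    simp only [map_sum, Finset.mul_sum]
    refine Finset.sum_congr rfl fun e he => ?_
    have hk : e.sum (fun _ a => a) = k := by
      rw [← hf (mem_support_iff.1 he), Finsupp.weight_apply]; simp
    simp only [aeval_monomial, eval_monomial, mul_pow, Finsupp.prod, map_mul, map_prod, map_pow,
      eval_C, Finset.prod_mul_distrib, algebraMap_eq, Finset.prod_pow_eq_pow_sum]
    rw [show ∑ i ∈ e.support, e i = k from hk]
    ring
  rw [this f hf, h, mul_zero, map_zero]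

theorem exists_X_sub_mem_linIdeal {p : σ → K} {c : σ} (hc : p c ≠ 0) (j : σ) :
    X j - C (p j) * (C (p c)⁻¹ * X c) ∈ linIdeal K {p} := by
  refine mem_linIdeal ((isHomogeneous_X _ _).sub ?_) ?_
  · simpa using ((isHomogeneous_C_mul_X _ _).C_mul (p j))
  · simp [hc]

theorem mem_linIdeal_singleton [Infinite K] {k : ℕ} {f : MvPolynomial σ K} (hf : f.IsHomogeneous k)
    {p : σ → K} (hp : p ≠ 0) (h : eval p f = 0) : f ∈ linIdeal K {p} := by
  obtain ⟨c, hc : p c ≠ 0⟩ := Function.ne_iff.1 hp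
  have h1 := sub_aeval_mem (I := linIdeal K {p}) (exists_X_sub_mem_linIdeal hc) f
  have h2 := aeval_C_mul_eq_zero hf h (C (p c)⁻¹ * X c)
  rw [h2, sub_zero] at h1
  exact h1

theorem mem_linIdeal_sq_iff [CharZero K] [Fintype σ] {k : ℕ} (hk : k ≠ 0) {f : MvPolynomial σ K}
    (hf : f.IsHomogeneous k) {p : σ → K} (hp : p ≠ 0) :
    f ∈ linIdeal K {p} ^ 2 ↔ ∀ j, eval p (pderiv j f) = 0 := by
  refine ⟨fun h j => eval_pderiv_of_mem_sq (fun g hg =>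
    eval_eq_zero_of_mem_linIdeal hg (Submodule.subset_span (Set.mem_singleton p))) h j, fun h => ?_⟩
  obtain ⟨c, hc : p c ≠ 0⟩ := Function.ne_iff.1 hp
  have h0 : eval p f = 0 := by
    have := euler_eval hf p
    simpa [h, hk] using this.symm
  have := taylor_mem_sq (a := fun j => C (p j) * (C (p c)⁻¹ * X c))
    (exists_X_sub_mem_linIdeal hc) f
  simpa only [aeval_C_mul_eq_zero hf h0, aeval_C_mul_eq_zero hf.pderiv (h _), mul_zero,
    Finset.sum_const_zero, sub_zero] using this

end

/-! ### The ideal of the base loci in adapted coordinates -/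

section
variable {K ι J : Type} [Field K]

theorem eval_aeval {K σ τ : Type*} [Field K] (v : τ → K) (g : σ → MvPolynomial τ K) (f : MvPolynomial σ K) :
    eval v (aeval g f) = eval (fun j => eval v (g j)) f := by
  induction f using MvPolynomial.induction_on with
  | C c => simp
  | add f g hf hg => rw [map_add, map_add, map_add, hf, hg]
  | mul_X f k hf => rw [map_mul, map_mul, map_mul, hf, aeval_X, eval_X]

theorem pderiv_mem_span {σ : Type} {S : Set (MvPolynomial σ K)} {i : σ} (h : ∀ f ∈ S, pderiv i f = 0)
    {f : MvPolynomial σ K} (hf : f ∈ Ideal.span S) : pderiv i f ∈ Ideal.span S := by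
  induction hf using Submodule.span_induction with
  | mem f hf => rw [h f hf]; exact zero_mem _
  | zero => simp
  | add f g _ _ hf hg => rw [map_add]; exact add_mem hf hg
  | smul a f hf' hf =>
    rw [smul_eq_mul, Derivation.leibniz]
    exact add_mem (Ideal.mul_mem_left _ _ hf) (Ideal.mul_mem_right _ _ hf')

theorem pderiv_inl_mem_pow {K ι J : Type} [Field K] {d : ℕ} (i : ι) {f : MvPolynomial (ι ⊕ J) K}
    (hf : f ∈ Ideal.span (Set.range fun j : J => X (.inr j)) ^ d) :
    pderiv (.inl i) f ∈ Ideal.span (Set.range fun j : J => X (.inr j)) ^ d := by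
  refine pderiv_mem_pow (fun g hg => pderiv_mem_span ?_ hg) d hf
  rintro _ ⟨j, rfl⟩
  exact pderiv_X_of_ne Sum.inr_ne_inl

theorem exists_rename_inr {K ι J : Type*} [Field K] [CharZero K] {f : MvPolynomial (ι ⊕ J) K}
    (h : ∀ i, pderiv (.inl i) f = 0) : ∃ g : MvPolynomial J K, rename .inr g = f := by
  refine exists_rename_eq_of_vars_subset_range f .inr Sum.inr_injective fun c hc => ?_
  rcases c with i | j
  · obtain ⟨e, he, hi⟩ := (mem_vars_iff_mem_support _).1 hc
    have h1 := coeff_pderiv (i := Sum.inl i) f (e - Finsupp.single (.inl i) 1)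
    rw [h i, tsub_add_cancel_of_le (Finsupp.single_le_iff.2
      (Nat.one_le_iff_ne_zero.2 (Finsupp.mem_support_iff.1 hi))), coeff_zero] at h1
    rcases mul_eq_zero.1 h1.symm with h2 | h2
    · exact absurd h2 (mem_support_iff.1 he)
    · exact absurd h2 (Nat.cast_add_one_ne_zero _)
  · exact ⟨j, rfl⟩

theorem exists_X_mul {d : ℕ} {z : J} {f : MvPolynomial J K} [Infinite K] [DecidableEq J]
    (hf : f.IsHomogeneous (d + 1)) (h : ∀ y : J → K, y z = 0 → eval y f = 0) :
    ∃ g : MvPolynomial J K, g.IsHomogeneous d ∧ f = X z * g := by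
  have h1 := sub_aeval_mem (I := Ideal.span {(X z : MvPolynomial J K)})
    (g := fun j => if j = z then 0 else X j) (fun j => by
      by_cases hj : j = z
      · simp [hj]
      · simp [hj]) f
  have h2 : aeval (fun j => if j = z then 0 else X j) f = (0 : MvPolynomial J K) := by
    refine MvPolynomial.funext fun v => ?_
    rw [eval_aeval, h _ (by simp), map_zero]
  rw [h2, sub_zero, Ideal.mem_span_singleton] at h1
  obtain ⟨g, rfl⟩ := h1
  exact ⟨g, isHomogeneous_of_X_mul hf, rfl⟩

variable [Fintype ι] [Fintype J] [DecidableEq ι] [DecidableEq J]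

theorem linIdeal_range_single_inl :
    linIdeal K (Set.range fun i : ι => (Pi.single (.inl i) 1 : ι ⊕ J → K))
      = Ideal.span (Set.range fun j : J => X (.inr j)) := by
  refine le_antisymm (Ideal.span_le.2 fun f ⟨hf, h⟩ => ?_) (Ideal.span_le.2 ?_)
  · obtain ⟨c, rfl⟩ := exists_eq_sum_X hf
    have hc : ∀ i, c (.inl i) = 0 := fun i => by
      simpa [Pi.single_apply] using h _ ⟨i, rfl⟩
    simp only [Fintype.sum_sum_type, hc, map_zero, zero_mul, Finset.sum_const_zero, zero_add]
    exact sum_mem fun j _ => Ideal.mul_mem_left _ _ (Ideal.subset_span ⟨j, rfl⟩)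
  · rintro _ ⟨j, rfl⟩
    exact mem_linIdeal (isHomogeneous_X _ _) (by simp)

theorem mem_pow_linIdeal_of_rename {d : ℕ} {g : MvPolynomial J K} (hg : g.IsHomogeneous d) :
    (rename .inr g : MvPolynomial (ι ⊕ J) K)
      ∈ linIdeal K (Set.range fun i : ι => (Pi.single (.inl i) 1 : ι ⊕ J → K)) ^ d := by
  have h : g ∈ idealOfVars J K ^ d := by
    rw [mem_pow_idealOfVars_iff']
    intro x hx
    exact hg.coeff_eq_zero hx.ne
  have h' := Ideal.mem_map_of_mem (rename (Sum.inr : J → ι ⊕ J) : _ →ₐ[K] _) h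
  rw [Ideal.map_pow, idealOfVars, Ideal.map_span, ← Set.range_comp] at h'
  rw [linIdeal_range_single_inl]
  have he : (rename Sum.inr ∘ X : J → MvPolynomial (ι ⊕ J) K) = fun j => X (.inr j) :=
    _root_.funext fun j => rename_X _ _
  rwa [he] at h'

theorem fibreForm_mem_inf {d : ℕ} (z : J) (B : Option ι → homogeneousSubmodule J K d) :
    fibreForm z d B ∈
      linIdeal K (Set.range fun i : ι => (Pi.single (.inl i) 1 : ι ⊕ J → K)) ^ d
        ⊓ linIdeal K {v | ∃ j ≠ z, v = (Pi.single (.inr j) 1 : ι ⊕ J → K)} := by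
  rw [fibreForm_apply]
  refine ⟨add_mem ?_ (sum_mem fun i _ => ?_), add_mem ?_ (sum_mem fun i _ => ?_)⟩
  · exact Ideal.mul_mem_left _ _ (mem_pow_linIdeal_of_rename (B none).2)
  · exact Ideal.mul_mem_left _ _ (mem_pow_linIdeal_of_rename (B (some i)).2)
  · refine Ideal.mul_mem_right _ _ (mem_linIdeal (isHomogeneous_X _ _) ?_)
    rintro _ ⟨j, hj, rfl⟩
    simp [hj.symm]
  · refine Ideal.mul_mem_right _ _ (mem_linIdeal (isHomogeneous_X _ _) ?_)
    rintro _ ⟨j, hj, rfl⟩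
    simp

theorem pderiv_inl_pderiv_inl_eq_zero {d : ℕ} (hd : d ≠ 0) {F : MvPolynomial (ι ⊕ J) K}
    (hF : F.IsHomogeneous (d + 1))
    (h1 : F ∈ linIdeal K (Set.range fun i : ι => (Pi.single (.inl i) 1 : ι ⊕ J → K)) ^ d)
    (i j : ι) : pderiv (.inl j) (pderiv (.inl i) F) = 0 := by
  rw [linIdeal_range_single_inl] at h1
  have hle : Ideal.span (Set.range fun j : J => (X (.inr j) : MvPolynomial (ι ⊕ J) K)) ^ d
      ≤ idealOfVars (ι ⊕ J) K ^ d :=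
    Ideal.pow_right_mono (Ideal.span_mono (by rintro _ ⟨j, rfl⟩; exact ⟨.inr j, rfl⟩)) d
  ext e
  rw [coeff_zero]
  have h3 := (mem_pow_idealOfVars_iff' _ _).1 (hle (pderiv_inl_mem_pow j (pderiv_inl_mem_pow i h1))) e
  have h4 : (pderiv (.inl j) (pderiv (.inl i) F)).IsHomogeneous (d - 1) := hF.pderiv.pderiv
  rcases lt_or_ge e.degree d with he | he
  · exact h3 he
  · exact h4.coeff_eq_zero (by omega)

theorem exists_eq_rename_add [CharZero K] {d : ℕ} {F : MvPolynomial (ι ⊕ J) K}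
    (hF : F.IsHomogeneous (d + 1)) (hF2 : ∀ i j, pderiv (.inl j) (pderiv (.inl i) F) = 0) :
    ∃ (A : MvPolynomial J K) (B : ι → MvPolynomial J K), A.IsHomogeneous (d + 1) ∧
      (∀ i, (B i).IsHomogeneous d) ∧ F = rename .inr A + ∑ i, X (.inl i) * rename .inr (B i) := by
  have hF1 (i) : (pderiv (.inl i) F).IsHomogeneous d := hF.pderiv
  choose B hB using fun i => exists_rename_inr (hF2 i)
  have hA : ∀ j, pderiv (.inl j) (F - ∑ i, X (.inl i) * pderiv (.inl i) F) = 0 := by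
    intro j
    simp [Derivation.leibniz, hF2, pderiv_X, Pi.single_apply]
  obtain ⟨A, hA⟩ := exists_rename_inr hA
  refine ⟨A, B, ?_, fun i => ?_, ?_⟩
  · rw [← IsHomogeneous.rename_isHomogeneous_iff Sum.inr_injective, hA]
    refine hF.sub (.sum _ _ _ fun i _ => ?_)
    rw [add_comm]
    exact (isHomogeneous_X _ _).mul (hF1 i)
  · rw [← IsHomogeneous.rename_isHomogeneous_iff Sum.inr_injective, hB]
    exact hF1 i
  · simp only [hA, hB, sub_add_cancel]

theorem exists_eq_fibreForm [CharZero K] {d : ℕ} (hd : d ≠ 0) (z : J) {F : MvPolynomial (ι ⊕ J) K}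
    (hF : F.IsHomogeneous (d + 1))
    (h1 : F ∈ linIdeal K (Set.range fun i : ι => (Pi.single (.inl i) 1 : ι ⊕ J → K)) ^ d)
    (h2 : F ∈ linIdeal K {v | ∃ j ≠ z, v = (Pi.single (.inr j) 1 : ι ⊕ J → K)}) :
    ∃ B, fibreForm z d B = F := by
  obtain ⟨A, B, hA, hB, rfl⟩ :=
    exists_eq_rename_add hF (pderiv_inl_pderiv_inl_eq_zero hd hF h1)
  have hA0 : ∀ y : J → K, y z = 0 → eval y A = 0 := by
    intro y hy
    have h3 := eval_eq_zero_of_mem_linIdeal h2 (v := Sum.elim 0 y) ?_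
    · simpa [eval_rename] using h3
    have : (Sum.elim 0 y : ι ⊕ J → K) = ∑ j, y j • Pi.single (.inr j) 1 := by
      ext c
      rcases c with i | k <;> simp [Pi.single_apply]
    rw [this]
    refine sum_mem fun j _ => ?_
    by_cases hj : j = z
    · simp [hj, hy]
    · exact Submodule.smul_mem _ _ (Submodule.subset_span ⟨j, hj, rfl⟩)
  obtain ⟨A', hA', rfl⟩ := exists_X_mul hA hA0
  refine ⟨fun k => k.elim ⟨A', hA'⟩ fun i => ⟨B i, hB i⟩, ?_⟩
  rw [fibreForm_apply, map_mul, rename_X]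
  rfl

end

/-! ### The homogeneous piece in adapted coordinates -/

section
variable {K ι J : Type} [Field K] [Fintype ι] [Fintype J] [DecidableEq ι] [DecidableEq J]

theorem rename_mem_linIdeal {K ι J : Type} [Field K] [Fintype J] [DecidableEq ι] [DecidableEq J]
    {f : MvPolynomial J K} {w : ι ⊕ J → K}
    (hf : f ∈ linIdeal K {fun j => w (.inr j)}) :
    rename .inr f
      ∈ linIdeal K (Set.range (fun i : ι => (Pi.single (.inl i) 1 : ι ⊕ J → K)) ∪ {w}) := by
  suffices h : linIdeal K {fun j => w (.inr j)} ≤ Ideal.comap (rename (Sum.inr : J → ι ⊕ J))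
      (linIdeal K (Set.range (fun i : ι => (Pi.single (.inl i) 1 : ι ⊕ J → K)) ∪ {w})) from h hf
  refine Ideal.span_le.2 fun g ⟨hg, h⟩ => mem_linIdeal hg.rename_isHomogeneous ?_
  rintro v (⟨i, rfl⟩ | rfl)
  · obtain ⟨c, rfl⟩ := exists_eq_sum_X hg
    simp
  · rw [eval_rename]
    exact h _ rfl

theorem fibreForm_mem_linIdeal_iff [Infinite K] {d : ℕ} {z : J}
    {B : Option ι → homogeneousSubmodule J K d} {w : ι ⊕ J → K} (hw : w (.inr z) ≠ 0) :
    fibreForm z d B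
        ∈ linIdeal K (Set.range (fun i : ι => (Pi.single (.inl i) 1 : ι ⊕ J → K)) ∪ {w}) ↔
      ∀ k, eval (fun j => w (.inr j)) (B k).1 = 0 := by
  set S := Set.range (fun i : ι => (Pi.single (.inl i) 1 : ι ⊕ J → K)) ∪ {w}
  constructor
  · intro h
    have hS (i) : (Pi.single (.inl i) 1 : ι ⊕ J → K) ∈ Submodule.span K S :=
      Submodule.subset_span (.inl ⟨i, rfl⟩)
    have h0 : (Sum.elim 0 fun j => w (.inr j) : ι ⊕ J → K) ∈ Submodule.span K S := by
      have : (Sum.elim 0 fun j => w (.inr j) : ι ⊕ J → K)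
          = w - ∑ i, w (.inl i) • (Pi.single (.inl i) 1 : ι ⊕ J → K) := by
        ext c
        rcases c with i | k <;> simp [Pi.single_apply]
      rw [this]
      exact sub_mem (Submodule.subset_span (.inr rfl))
        (sum_mem fun i _ => Submodule.smul_mem _ _ (hS i))
    have hnone : eval (fun j => w (.inr j)) (B none).1 = 0 := by
      simpa [eval_fibreForm, hw] using eval_eq_zero_of_mem_linIdeal h h0
    rintro (_ | i)
    · exact hnone
    · simpa [eval_fibreForm, hnone, Pi.single_apply] using
        eval_eq_zero_of_mem_linIdeal h (add_mem h0 (hS i))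
  · intro h
    have hmem (k) : rename .inr (B k).1 ∈ linIdeal K S :=
      rename_mem_linIdeal (mem_linIdeal_singleton (B k).2 (fun h' => hw (congrFun h' z)) (h k))
    rw [fibreForm_apply]
    exact add_mem (Ideal.mul_mem_left _ _ (hmem _))
      (sum_mem fun i _ => Ideal.mul_mem_left _ _ (hmem _))

theorem finrank_piece_eq_finrank_kerAt [CharZero K] {S T : Type} {d : ℕ} (hd : d ≠ 0) {z : J}
    {x : (S ⊕ T) × (ι ⊕ J) → K} (hp : ∀ i, (fun c => x (.inl i, c)) ≠ 0)
    (hw : ∀ i, x (.inr i, .inr z) ≠ 0) :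
    Module.finrank K (piece K
      (linIdeal K (Set.range fun i : ι => (Pi.single (.inl i) 1 : ι ⊕ J → K)) ^ d
        ⊓ linIdeal K {v | ∃ j ≠ z, v = (Pi.single (.inr j) 1 : ι ⊕ J → K)}
        ⊓ (⨅ i : S, linIdeal K {fun c => x (.inl i, c)} ^ 2)
        ⊓ (⨅ i : T, linIdeal K (Set.range (fun i : ι => (Pi.single (.inl i) 1 : ι ⊕ J → K))
          ∪ {fun c => x (.inr i, c)}))) (d + 1))
      = Module.finrank K (kerAt (conds K ι S T z d) x) := by
  have key (B : Option ι → homogeneousSubmodule J K d) :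
      B ∈ kerAt (conds K ι S T z d) x ↔
        fibreForm z d B ∈ (⨅ i : S, linIdeal K {fun c => x (.inl i, c)} ^ 2) ∧
        fibreForm z d B ∈ (⨅ i : T, linIdeal K
          (Set.range (fun i : ι => (Pi.single (.inl i) 1 : ι ⊕ J → K))
            ∪ {fun c => x (.inr i, c)})) := by
    rw [mem_kerAt_conds, Ideal.mem_iInf, Ideal.mem_iInf]
    exact and_congr
      (forall_congr' fun i =>
        (mem_linIdeal_sq_iff d.succ_ne_zero (isHomogeneous_fibreForm z B) (hp i)).symm)
      (forall_congr' fun i =>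
        (fibreForm_mem_linIdeal_iff (w := fun c => x (.inr i, c)) (hw i)).symm)
  rw [(Submodule.equivMapOfInjective _ (fibreForm_injective z)
    (kerAt (conds K ι S T z d) x)).finrank_eq]
  refine congrArg (fun V : Submodule K (MvPolynomial (ι ⊕ J) K) => Module.finrank K V)
    (Submodule.ext fun F => ?_)
  rw [Submodule.mem_map]
  constructor
  · rintro ⟨⟨⟨⟨h1, h2⟩, h3⟩, h4⟩, h5⟩
    obtain ⟨B, rfl⟩ := exists_eq_fibreForm hd z h5 h1 h2
    exact ⟨B, (key B).2 ⟨h3, h4⟩, rfl⟩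
  · rintro ⟨B, hB, rfl⟩
    have h := (key B).1 hB
    exact ⟨⟨⟨fibreForm_mem_inf z B, h.1⟩, h.2⟩, isHomogeneous_fibreForm z B⟩

end

/-! ### Linear changes of coordinates -/

section
variable {K : Type} [Field K] {σ σ' : Type} [Fintype σ'] [DecidableEq σ']

/-- Composition of polynomials with a linear map. -/
def linSubst (L : (σ' → K) →ₗ[K] (σ → K)) : MvPolynomial σ K →ₐ[K] MvPolynomial σ' K :=
  aeval fun c => ∑ c', C (L (Pi.single c' 1) c) * X c'

theorem eval_linSubst (L : (σ' → K) →ₗ[K] (σ → K)) (v : σ' → K) (f : MvPolynomial σ K) :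
    eval v (linSubst L f) = eval (L v) f := by
  have hL : L v = ∑ c', v c' • L (Pi.single c' 1) := by
    conv_lhs => rw [← Finset.univ_sum_single v, map_sum]
    exact Finset.sum_congr rfl fun c' _ => by
      rw [← map_smul, ← Pi.single_smul, smul_eq_mul, mul_one]
  rw [linSubst, eval_aeval, hL]
  congr 2
  ext c
  simp [mul_comm]

theorem isHomogeneous_linSubst (L : (σ' → K) →ₗ[K] (σ → K)) {f : MvPolynomial σ K} {k : ℕ}
    (hf : f.IsHomogeneous k) : (linSubst L f).IsHomogeneous k := by
  have := hf.aeval (fun c => ∑ c', C (L (Pi.single c' 1) c) * X c') (n := 1)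
    fun c => .sum _ _ _ fun c' _ => isHomogeneous_C_mul_X _ _
  rwa [one_mul] at this

variable [Fintype σ] [DecidableEq σ]

/-- Linear change of coordinates in a polynomial ring. -/
def linSubstEquiv [Infinite K] (L : (σ' → K) ≃ₗ[K] (σ → K)) :
    MvPolynomial σ K ≃ₐ[K] MvPolynomial σ' K :=
  AlgEquiv.ofAlgHom (linSubst L.toLinearMap) (linSubst L.symm.toLinearMap)
    (AlgHom.ext fun f => MvPolynomial.funext fun v => by simp [eval_linSubst])
    (AlgHom.ext fun f => MvPolynomial.funext fun v => by simp [eval_linSubst])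

variable [Infinite K]

theorem map_linIdeal (L : (σ' → K) ≃ₗ[K] (σ → K)) {S : Set (σ → K)} {S' : Set (σ' → K)}
    (h1 : ∀ x ∈ S', L x ∈ Submodule.span K S)
    (h2 : ∀ x ∈ S, ∃ y ∈ Submodule.span K S', L y = x) :
    Ideal.map (linSubstEquiv L) (linIdeal K S) = linIdeal K S' := by
  refine le_antisymm ?_ ?_
  · refine Ideal.map_le_iff_le_comap.2 (Ideal.span_le.2 fun f hf => ?_)
    refine mem_linIdeal (isHomogeneous_linSubst L.toLinearMap hf.1) fun x hx => ?_
    exact (eval_linSubst L.toLinearMap x f).trans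
      (eval_eq_zero_of_mem_linIdeal (Ideal.subset_span hf) (h1 x hx))
  · refine Ideal.span_le.2 fun f hf => ?_
    have := Ideal.mem_map_of_mem (linSubstEquiv L) (I := linIdeal K S)
      (x := (linSubstEquiv L).symm f) ?_
    · rwa [AlgEquiv.apply_symm_apply] at this
    refine mem_linIdeal (isHomogeneous_linSubst L.symm.toLinearMap hf.1) fun x hx => ?_
    obtain ⟨y, hy, rfl⟩ := h2 x hx
    refine (eval_linSubst L.symm.toLinearMap (L y) f).trans ?_
    rw [LinearEquiv.coe_coe, LinearEquiv.symm_apply_apply]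
    exact eval_eq_zero_of_mem_linIdeal (Ideal.subset_span hf) hy

theorem mem_map_linSubstEquiv {L : (σ' → K) ≃ₗ[K] (σ → K)} {I : Ideal (MvPolynomial σ K)}
    {f : MvPolynomial σ' K} :
    f ∈ I.map (linSubstEquiv L) ↔ (linSubstEquiv L).symm f ∈ I := by
  rw [Ideal.mem_map_of_equiv]
  constructor
  · rintro ⟨g, hg, rfl⟩
    rwa [AlgEquiv.symm_apply_apply]
  · exact fun h => ⟨_, h, (linSubstEquiv L).apply_symm_apply f⟩

theorem finrank_piece_map (L : (σ' → K) ≃ₗ[K] (σ → K)) (I : Ideal (MvPolynomial σ K)) (k : ℕ) :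
    Module.finrank K (piece K (I.map (linSubstEquiv L)) k) = Module.finrank K (piece K I k) := by
  have : piece K (I.map (linSubstEquiv L)) k
      = (piece K I k).map ((linSubstEquiv L).toLinearEquiv : _ →ₗ[K] _) := by
    ext f
    rw [Submodule.mem_map]
    constructor
    · rintro ⟨h1, h2⟩
      refine ⟨(linSubstEquiv L).symm f,
        ⟨mem_map_linSubstEquiv.1 h1, isHomogeneous_linSubst L.symm.toLinearMap h2⟩,
        (linSubstEquiv L).apply_symm_apply f⟩
    · rintro ⟨g, ⟨h1, h2⟩, rfl⟩
      exact ⟨Ideal.mem_map_of_mem (linSubstEquiv L) h1, isHomogeneous_linSubst L.toLinearMap h2⟩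
  rw [this]
  exact LinearEquiv.finrank_map_eq _ _

theorem map_inf_linSubstEquiv (L : (σ' → K) ≃ₗ[K] (σ → K)) (I I' : Ideal (MvPolynomial σ K)) :
    (I ⊓ I').map (linSubstEquiv L) = I.map (linSubstEquiv L) ⊓ I'.map (linSubstEquiv L) := by
  ext f
  simp only [Ideal.mem_inf, mem_map_linSubstEquiv]

theorem map_iInf_linSubstEquiv (L : (σ' → K) ≃ₗ[K] (σ → K)) {S : Type}
    (I : S → Ideal (MvPolynomial σ K)) :
    (⨅ i, I i).map (linSubstEquiv L) = ⨅ i, (I i).map (linSubstEquiv L) := by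
  ext f
  simp only [Ideal.mem_iInf, mem_map_linSubstEquiv]

end

/-! ### Generic configurations in coordinates adapted to them -/

section
variable {K : Type*} [Field K] {τ τ' : Type*}

theorem Gen.subst [Infinite K] {Φ : (τ → K) → Prop} (h : Gen Φ) (G : τ → MvPolynomial τ' K)
    (hG : ∀ x : τ → K, ∃ y, ∀ i, eval y (G i) = x i) :
    Gen fun y : τ' → K => Φ fun i => eval y (G i) := by
  obtain ⟨g, hg, hΦ⟩ := h
  have heval (y : τ' → K) : eval y (aeval G g) = eval (fun i => eval y (G i)) g :=
    eval_aeval y G g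
  refine ⟨aeval G g, fun h0 => hg (MvPolynomial.funext fun x => ?_), fun y hy => hΦ _ ?_⟩
  · obtain ⟨y, hy⟩ := hG x
    rw [← _root_.funext hy, ← heval, h0, map_zero, map_zero]
  · rwa [← heval]

theorem Gen.adapted [Infinite K] {A B C U : Type*} [Fintype C] [DecidableEq C] {R : C ⊕ U → A}
    {col : C → B} (hR : R.Injective) (hcol : col.Injective) {Φ : (U × C → K) → Prop} (h : Gen Φ) :
    Gen fun x : A × B → K =>
      (Matrix.of fun k k' => x (R (.inl k), col k')).det ≠ 0 ∧
      Φ fun u => Matrix.vecMul (fun k => x (R (.inr u.1), col k))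
        (Matrix.of fun k k' => x (R (.inl k), col k')).adjugate u.2 := by
  let MX : Matrix C C (MvPolynomial (A × B) K) := Matrix.of fun k k' => X (R (.inl k), col k')
  let G : U × C → MvPolynomial (A × B) K := fun u =>
    Matrix.vecMul (fun k => X (R (.inr u.1), col k)) MX.adjugate u.2
  have hMX (x : A × B → K) :
      (eval x).mapMatrix MX = Matrix.of fun k k' => x (R (.inl k), col k') := by
    ext k k'
    simp [MX]
  have hG (x : A × B → K) (u : U × C) : eval x (G u)
      = Matrix.vecMul (fun k => x (R (.inr u.1), col k))
        (Matrix.of fun k k' => x (R (.inl k), col k')).adjugate u.2 := by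
    rw [← hMX, ← RingHom.map_adjugate]
    simp [G, Matrix.vecMul, dotProduct]
  have hex (x₀ : U × C → K) : ∃ x : A × B → K,
      (Matrix.of fun k k' => x (R (.inl k), col k')) = 1 ∧
      ∀ u c, x (R (.inr u), col c) = x₀ (u, c) := by
    let f : (C ⊕ U) × C → K := fun p => p.1.elim (fun k => (1 : Matrix C C K) k p.2)
      fun u => x₀ (u, p.2)
    have hinj := hR.prodMap hcol
    refine ⟨Function.extend (Prod.map R col) f 0, ?_, fun u c => ?_⟩
    · ext k k'
      exact hinj.extend_apply f 0 (.inl k, k')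
    · exact hinj.extend_apply f 0 (.inr u, c)
  refine Gen.and ⟨MX.det, fun h0 => ?_, fun x hx => ?_⟩ ?_
  · obtain ⟨x, hx, -⟩ := hex 0
    have := congrArg (eval x) h0
    rw [RingHom.map_det, hMX, hx, Matrix.det_one, map_zero] at this
    exact one_ne_zero this
  · rwa [RingHom.map_det, hMX] at hx
  · refine (h.subst G fun x₀ => ?_).mono fun x hx => ?_
    · obtain ⟨x, hx, hx₀⟩ := hex x₀
      refine ⟨x, fun u => ?_⟩
      rw [hG, hx, Matrix.adjugate_one, Matrix.vecMul_one, hx₀]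
    · simpa only [hG] using hx

end

section
variable {K ι J σ : Type} [Field K] [Fintype ι] [Fintype J] [DecidableEq ι] [DecidableEq J]

theorem exists_linearEquiv_vecMul {C : Type} [Fintype C] [DecidableEq C] (e : C ≃ σ)
    {M : Matrix C C K} (hM : M.det ≠ 0) :
    ∃ L : (C → K) ≃ₗ[K] (σ → K), ∀ y c, L y (e c) = Matrix.vecMul y M c := by
  have hu : IsUnit M.det := hM.isUnit
  refine ⟨(Matrix.toLinearEquivRight'OfInv (Matrix.nonsing_inv_mul M hu)
    (Matrix.mul_nonsing_inv M hu)).trans (LinearEquiv.funCongrLeft K K e.symm), fun y c => ?_⟩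
  simp [LinearMap.funLeft]

variable [Fintype σ] [DecidableEq σ]

/-- The homogeneous piece for an arbitrary configuration, computed in the coordinates given by the
rows of `M`. -/
theorem finrank_piece_eq_of_rows [CharZero K] {S T : Type} {d : ℕ} (hd : d ≠ 0) {z : J}
    (e : ι ⊕ J ≃ σ) {M : Matrix (ι ⊕ J) (ι ⊕ J) K} (hM : M.det ≠ 0) {a : ι → σ → K}
    (ha : ∀ i c, a i (e c) = M (.inl i) c) {B : Set (σ → K)}
    (hB₁ : ∀ v ∈ B, ∃ j ≠ z, ∀ c, v (e c) = M (.inr j) c)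
    (hB₂ : ∀ j ≠ z, ∃ v ∈ B, ∀ c, v (e c) = M (.inr j) c) {pt : S → σ → K} {w : T → σ → K}
    {x : (S ⊕ T) × (ι ⊕ J) → K}
    (hx₁ : ∀ i c, x (.inl i, c) = Matrix.vecMul (fun k => pt i (e k)) M.adjugate c)
    (hx₂ : ∀ i c, x (.inr i, c) = Matrix.vecMul (fun k => w i (e k)) M.adjugate c)
    (hx₀ : ∀ u, x (u, .inr z) ≠ 0) :
    Module.finrank K (piece K
      (linIdeal K (Set.range a) ^ d ⊓ linIdeal K B ⊓ (⨅ i, linIdeal K {pt i} ^ 2)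
        ⊓ (⨅ i, linIdeal K (Set.range a ∪ {w i}))) (d + 1))
      = Module.finrank K (kerAt (conds K ι S T z d) x) := by
  obtain ⟨L, hL⟩ := exists_linearEquiv_vecMul e hM
  have hLsingle (k : ι ⊕ J) (v : σ → K) (hv : ∀ c, v (e c) = M k c) : L (Pi.single k 1) = v := by
    ext c
    obtain ⟨c, rfl⟩ := e.surjective c
    rw [hL, hv, Matrix.single_one_vecMul]
    rfl
  have hLadj (v : σ → K) (y : ι ⊕ J → K)
      (hy : ∀ c, y c = Matrix.vecMul (fun k => v (e k)) M.adjugate c) : L y = M.det • v := by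
    ext c
    obtain ⟨c, rfl⟩ := e.surjective c
    rw [hL, _root_.funext hy, Matrix.vecMul_vecMul, Matrix.adjugate_mul, Matrix.vecMul_smul,
      Matrix.vecMul_one]
    rfl
  have hLadj' (v : σ → K) (y : ι ⊕ J → K)
      (hy : ∀ c, y c = Matrix.vecMul (fun k => v (e k)) M.adjugate c) :
      L (M.det⁻¹ • y) = v := by
    rw [map_smul, hLadj v y hy, smul_smul, inv_mul_cancel₀ hM, one_smul]
  have hLa (i) : L (Pi.single (.inl i) 1) = a i := hLsingle _ _ (ha i)
  have h1 : Ideal.map (linSubstEquiv L) (linIdeal K (Set.range a))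
      = linIdeal K (Set.range fun i : ι => (Pi.single (.inl i) 1 : ι ⊕ J → K)) := by
    refine map_linIdeal L ?_ ?_
    · rintro _ ⟨i, rfl⟩
      exact Submodule.subset_span ⟨i, (hLa i).symm⟩
    · rintro _ ⟨i, rfl⟩
      exact ⟨_, Submodule.subset_span ⟨i, rfl⟩, hLa i⟩
  have h2 : Ideal.map (linSubstEquiv L) (linIdeal K B)
      = linIdeal K {v | ∃ j ≠ z, v = (Pi.single (.inr j) 1 : ι ⊕ J → K)} := by
    refine map_linIdeal L ?_ ?_
    · rintro _ ⟨j, hj, rfl⟩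
      obtain ⟨v, hv, hvj⟩ := hB₂ j hj
      rw [hLsingle _ _ hvj]
      exact Submodule.subset_span hv
    · intro v hv
      obtain ⟨j, hj, hvj⟩ := hB₁ v hv
      exact ⟨_, Submodule.subset_span ⟨j, hj, rfl⟩, hLsingle _ _ hvj⟩
  have h3 (i) : Ideal.map (linSubstEquiv L) (linIdeal K {pt i})
      = linIdeal K {fun c => x (.inl i, c)} := by
    refine map_linIdeal L ?_ ?_
    · rintro _ rfl
      rw [hLadj _ _ (hx₁ i)]
      exact Submodule.smul_mem _ _ (Submodule.mem_span_singleton_self _)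
    · rintro _ rfl
      exact ⟨_, Submodule.smul_mem _ _ (Submodule.mem_span_singleton_self _), hLadj' _ _ (hx₁ i)⟩
  have h4 (i) : Ideal.map (linSubstEquiv L) (linIdeal K (Set.range a ∪ {w i}))
      = linIdeal K (Set.range (fun i : ι => (Pi.single (.inl i) 1 : ι ⊕ J → K))
          ∪ {fun c => x (.inr i, c)}) := by
    refine map_linIdeal L ?_ ?_
    · rintro _ (⟨k, rfl⟩ | rfl)
      · exact Submodule.subset_span (.inl ⟨k, (hLa k).symm⟩)
      · rw [hLadj _ _ (hx₂ i)]
        exact Submodule.smul_mem _ _ (Submodule.subset_span (.inr rfl))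
    · rintro _ (⟨k, rfl⟩ | rfl)
      · exact ⟨_, Submodule.subset_span (.inl ⟨k, rfl⟩), hLa k⟩
      · exact ⟨_, Submodule.smul_mem _ _ (Submodule.subset_span (.inr rfl)), hLadj' _ _ (hx₂ i)⟩
  have h5 : Ideal.map (linSubstEquiv L)
      (linIdeal K (Set.range a) ^ d ⊓ linIdeal K B ⊓ (⨅ i, linIdeal K {pt i} ^ 2)
        ⊓ (⨅ i, linIdeal K (Set.range a ∪ {w i})))
      = linIdeal K (Set.range fun i : ι => (Pi.single (.inl i) 1 : ι ⊕ J → K)) ^ d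
        ⊓ linIdeal K {v | ∃ j ≠ z, v = (Pi.single (.inr j) 1 : ι ⊕ J → K)}
        ⊓ (⨅ i : S, linIdeal K {fun c => x (.inl i, c)} ^ 2)
        ⊓ (⨅ i : T, linIdeal K (Set.range (fun i : ι => (Pi.single (.inl i) 1 : ι ⊕ J → K))
          ∪ {fun c => x (.inr i, c)})) := by
    simp only [map_inf_linSubstEquiv, map_iInf_linSubstEquiv, Ideal.map_pow, h1, h2, h3, h4]
  rw [← finrank_piece_map L, h5]
  exact finrank_piece_eq_finrank_kerAt hd (fun i h => hx₀ (.inl i) (congrFun h _))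
    fun i => hx₀ (.inr i)

end

theorem gen_finrank_kerAt_conds_eq (K : Type*) [Field K] [CharZero K] {n m d q : ℕ} (t : ℕ)
    (hd : 3 ≤ d) (hn : 1 ≤ n) :
    Gen fun x : (Option (Fin n) × Fin q ⊕ Fin t) × (Fin n ⊕ Fin (m + 1)) → K =>
      (∀ u, x (u, .inr (Fin.last m)) ≠ 0) ∧
      (Module.finrank K (kerAt (conds K (Fin n) (Option (Fin n) × Fin q) (Fin t)
        (Fin.last m) d) x) : ℤ)
        = max ((n + 1) * ((m + d).choose d) - ((n + 1) * q : ℕ) * (n + m + 1) - t * (n + 1) : ℤ) 0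
      := by
  obtain ⟨x₀, hx₀⟩ := exists_finrank_kerAt_conds_le K (M := m + 1) (q := q) (t := t) hd
    (Nat.succ_pos m) hn (Fin.last m)
  refine (Gen.all fun u => Gen.coord_ne_zero (u, _)).and ((Gen.of_kerAt _ x₀ hx₀).mono ?_)
  intro x hx
  have hlow := finrank_le_finrank_kerAt_add
    (conds K (Fin n) (Option (Fin n) × Fin q) (Fin t) (Fin.last m) d) x
  rw [finrank_fibre] at hlow
  simp only [Fintype.card_fin, Fintype.card_sum, Fintype.card_prod, Fintype.card_option] at hlow
  rw [Nat.multichoose_eq, show m + 1 + d - 1 = m + d by omega] at hx hlow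
  generalize (m + d).choose d = N at *
  generalize Module.finrank K (kerAt (conds K (Fin n) (Option (Fin n) × Fin q) (Fin t)
    (Fin.last m) d) x) = F at *
  rcases le_total N (q * (m + 1) + (n * q + t)) with h | h
  · rw [Nat.sub_eq_zero_of_le h, mul_zero, Nat.le_zero] at hx
    rw [hx, max_eq_right]
    · rfl
    · zify at h
      push_cast
      nlinarith
  · obtain ⟨k, rfl⟩ := Nat.exists_eq_add_of_le h
    rw [Nat.add_sub_cancel_left] at hx
    have : F = (n + 1) * k := by nlinarith
    rw [this, max_eq_left] <;> push_cast <;> nlinarith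

/-- The row of parameters used for each vector of the configuration; the last coordinate vector
gets a row of its own. -/
def configRow (n m t s : ℕ) {S : Type} (ψ : S ≃ Fin s) :
    (Fin n ⊕ Fin (m + 1)) ⊕ (S ⊕ Fin t) → ℕ
  | .inl (.inl i) => i
  | .inl (.inr j) => if (j : ℕ) < m then n + j else n + m + t + s
  | .inr (.inl i) => n + m + t + ψ i
  | .inr (.inr j) => n + m + j

theorem configRow_injective (n m t s : ℕ) {S : Type} (ψ : S ≃ Fin s) :
    Function.Injective (configRow n m t s ψ) := by
  have hψ (i) := (ψ i).2
  rintro ((i | i) | (i | i)) ((j | j) | (j | j)) h <;>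
    simp only [configRow] at h <;>
    first
    | (exfalso; have := hψ i; have := hψ j; split_ifs at h <;> omega)
    | (exfalso; have := hψ i; split_ifs at h <;> omega)
    | (exfalso; have := hψ j; split_ifs at h <;> omega)
    | (exfalso; split_ifs at h <;> omega)
    | (exfalso; omega)
    | (congr 2; ext; split_ifs at h <;> omega)
    | (congr 2; ext; omega)
    | (congr 2; exact ψ.injective (Fin.ext (by omega)))

/-- **Theorem (main theorem of the paper).**  Let `d ≥ 3`, `n, m ≥ 1`, `s = (n+1)q`.
For a generic configuration (generic = the parameters avoid the zero locus of some
nonzero polynomial `g`) consisting of: a linear space `H₁ = ⟨a₁,…,aₙ⟩ ≅ P^{n-1}`,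
a linear space `H₂ = ⟨b₁,…,b_m⟩ ≅ P^{m-1}`, `t` linear spaces `Wⱼ = ⟨H₁, wⱼ⟩ ≅ P^n`
containing `H₁`, and `s` points `pt₁,…,pt_s` in `P^{n+m}`, the scheme
`X = dH₁ + H₂ + 2pt₁ + ⋯ + 2pt_s + W₁ + ⋯ + W_t` (defined by the ideal
`I_{H₁}^d ∩ I_{H₂} ∩ I_{pt₁}² ∩ ⋯ ∩ I_{pt_s}² ∩ I_{W₁} ∩ ⋯ ∩ I_{W_t}`) satisfies
`dim (I_X)_{d+1} = max { (n+1)·C(m+d,d) − s(n+m+1) − t(n+1) ; 0 }`. -/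
theorem stmt0 (K : Type) [Field K] [IsAlgClosed K] [CharZero K]
    (n m d q t : ℕ) (hd : 3 ≤ d) (hn : 1 ≤ n) (hm : 1 ≤ m)
    (s : ℕ) (hs : s = (n + 1) * q) :
    ∃ g : MvPolynomial (ℕ × ℕ) K, g ≠ 0 ∧
      ∀ P : ℕ → ℕ → K, MvPolynomial.eval (fun ij => P ij.1 ij.2) g ≠ 0 →
        let a : Fin n → (Fin (n + m + 1) → K) := fun i c => P (i : ℕ) (c : ℕ)
        let b : Fin m → (Fin (n + m + 1) → K) := fun i c => P (n + (i : ℕ)) (c : ℕ)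
        let w : Fin t → (Fin (n + m + 1) → K) := fun i c => P (n + m + (i : ℕ)) (c : ℕ)
        let pt : Fin s → (Fin (n + m + 1) → K) := fun i c => P (n + m + t + (i : ℕ)) (c : ℕ)
        let IX : Ideal (MvPolynomial (Fin (n + m + 1)) K) :=
          (linIdeal K (Set.range a)) ^ d ⊓ linIdeal K (Set.range b)
            ⊓ (⨅ i : Fin s, (linIdeal K {pt i}) ^ 2)
            ⊓ (⨅ j : Fin t, linIdeal K (Set.range a ∪ {w j}))
        (Module.finrank K (piece K IX (d + 1)) : ℤ)
          = max ((n + 1) * ((m + d).choose d) - s * (n + m + 1) - t * (n + 1) : ℤ) 0 := by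
  subst hs
  let ψ : Option (Fin n) × Fin q ≃ Fin ((n + 1) * q) :=
    Fintype.equivFinOfCardEq (by simp)
  let e : Fin n ⊕ Fin (m + 1) ≃ Fin (n + m + 1) := finSumFinEquiv
  obtain ⟨g, hg, hgP⟩ := (gen_finrank_kerAt_conds_eq K (m := m) (q := q) t hd hn).adapted
    (configRow_injective n m t _ ψ) (Fin.val_injective.comp e.injective)
  refine ⟨g, hg, fun P hP => ?_⟩
  intro a b w pt IX
  obtain ⟨hdet, hne, hdim⟩ := hgP _ hP
  rw [← hdim, ← finrank_piece_eq_of_rows (B := Set.range b) (a := a) (pt := fun u => pt (ψ u)) (w := w)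
    (by omega) e hdet (fun i c => rfl) ?_ ?_ (fun i c => rfl) (fun i c => rfl) hne,
    ψ.iInf_comp (g := fun i => linIdeal K {pt i} ^ 2)]
  · rintro _ ⟨i, rfl⟩
    refine ⟨i.castSucc, (Fin.castSucc_lt_last i).ne, fun c => ?_⟩
    simp [configRow, b]
  · intro j hj
    obtain ⟨i, rfl⟩ := Fin.exists_castSucc_eq.2 hj
    refine ⟨_, ⟨i, rfl⟩, fun c => ?_⟩
    simp [configRow, b]
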